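/- Assume the Riemann Hypothesis. Then for every real x ≥ 2 one has ∑_{n > x} Λ(n)/(n^{3/2}·log n) ≤ 2/(√x·log x) + 5·(1+log x)/(16πx), where the sum runs over all integers n > x. -/

import Mathlib

section

open Complex Filter Topology Set MeasureTheory

/-- The entire function `s (s - 1) π^(-s/2) Γ(s/2) ζ(s)`. -/
noncomputable def riemannXi (s : ℂ) : ℂ := s * (s - 1) * completedRiemannZeta₀ s + 1

lemma differentiable_riemannXi : Differentiable ℂ riemannXi := by
  unfold riemannXi
  have := differentiable_completedZeta₀
  fun_prop

lemma riemannXi_one_sub (s : ℂ) : riemannXi (1 - s) = riemannXi s := by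
  simp only [riemannXi, completedRiemannZeta₀_one_sub]; ring

lemma riemannXi_one : riemannXi 1 = 1 := by simp [riemannXi]

lemma riemannXi_eq_mul_riemannZeta {s : ℂ} (hs : 0 < s.re) (hs1 : s ≠ 1) :
    riemannXi s = s * (s - 1) * Gammaℝ s * riemannZeta s := by
  have h0 : s ≠ 0 := by rintro rfl; simp at hs
  have h1 : 1 - s ≠ 0 := sub_ne_zero.2 hs1.symm
  rw [riemannZeta_def_of_ne_zero h0, completedRiemannZeta_eq, riemannXi]
  have := Gammaℝ_ne_zero_of_re_pos hs
  field_simp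
  ring

lemma riemannXi_ne_zero_of_riemannHypothesis (hRH : RiemannHypothesis) {s : ℂ}
    (hs : 1 / 2 < s.re) : riemannXi s ≠ 0 := by
  rcases eq_or_ne s 1 with rfl | h1
  · simp [riemannXi_one]
  have h0 : s ≠ 0 := by rintro rfl; norm_num at hs
  rw [riemannXi_eq_mul_riemannZeta (by linarith) h1]
  refine mul_ne_zero (mul_ne_zero (mul_ne_zero h0 (sub_ne_zero.2 h1))
    (Gammaℝ_ne_zero_of_re_pos (by linarith))) fun hz ↦ ?_
  have := hRH s hz ?_ h1
  · linarith
  · rintro ⟨n, rfl⟩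
    norm_num at hs
    have : (0:ℝ) ≤ n := n.cast_nonneg
    linarith

lemma Gammaℝ_conj (s : ℂ) : Gammaℝ (starRingEnd ℂ s) = starRingEnd ℂ (Gammaℝ s) := by
  have hpi : (Real.pi : ℂ).arg ≠ Real.pi := by
    rw [arg_ofReal_of_nonneg Real.pi_pos.le]; exact Real.pi_pos.ne
  have h : starRingEnd ℂ (-s / 2) = -starRingEnd ℂ s / 2 := by rw [map_div₀, map_neg, map_ofNat]
  have h' : starRingEnd ℂ (s / 2) = starRingEnd ℂ s / 2 := by rw [map_div₀, map_ofNat]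
  rw [Gammaℝ_def, Gammaℝ_def, map_mul, ← Gamma_conj, ← h, ← h', cpow_conj _ _ hpi, conj_ofReal]

lemma riemannXi_conj {s : ℂ} (hs : 0 < s.re) :
    riemannXi (starRingEnd ℂ s) = starRingEnd ℂ (riemannXi s) := by
  rcases eq_or_ne s 1 with rfl | h1
  · simp [riemannXi_one]
  rw [riemannXi_eq_mul_riemannZeta hs h1, riemannXi_eq_mul_riemannZeta (by simpa)
    ((map_ne_one_iff _ (starRingEnd ℂ).injective).mpr h1),
    Gammaℝ_conj, riemannZeta_conj]
  simp

lemma norm_mellin_le {f : ℝ → ℂ} {a b : ℝ} (hf : ∀ s : ℂ, MellinConvergent f s) {s : ℂ}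
    (ha : a ≤ s.re) (hb : s.re ≤ b) :
    ‖mellin f s‖ ≤ (∫ t in Ioi (0:ℝ), ‖(t:ℂ) ^ ((a:ℂ) - 1) • f t‖) +
      ∫ t in Ioi (0:ℝ), ‖(t:ℂ) ^ ((b:ℂ) - 1) • f t‖ := by
  rw [mellin, ← integral_add (hf a).norm (hf b).norm]
  refine (norm_integral_le_integral_norm _).trans ?_
  refine setIntegral_mono_on (hf s).norm ((hf a).norm.add (hf b).norm) measurableSet_Ioi ?_
  intro t (ht : 0 < t)
  simp only [norm_smul, norm_cpow_eq_rpow_re_of_pos ht, sub_re, ofReal_re, one_re, ← add_mul]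
  refine mul_le_mul_of_nonneg_right ?_ (norm_nonneg _)
  rcases le_total t 1 with h | h
  · have := Real.rpow_le_rpow_of_exponent_ge ht h (sub_le_sub_right ha 1)
    have := Real.rpow_nonneg ht.le (b - 1)
    linarith
  · have := Real.rpow_le_rpow_of_exponent_le h (sub_le_sub_right hb 1)
    have := Real.rpow_nonneg ht.le (a - 1)
    linarith

lemma exists_norm_completedRiemannZeta₀_le (a b : ℝ) :
    ∃ C, ∀ s : ℂ, a ≤ s.re → s.re ≤ b → ‖completedRiemannZeta₀ s‖ ≤ C := by
  set P := HurwitzZeta.hurwitzEvenFEPair 0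
  have hP := P.isStrongFEPair_toStrongFEPair
  have hc (s : ℂ) : MellinConvergent P.f_modif s := (hP.hasMellin s).1
  refine ⟨((∫ t in Ioi (0:ℝ), ‖(t:ℂ) ^ (((a / 2 : ℝ) : ℂ) - 1) • P.f_modif t‖) +
      ∫ t in Ioi (0:ℝ), ‖(t:ℂ) ^ (((b / 2 : ℝ) : ℂ) - 1) • P.f_modif t‖) / ‖(2:ℂ)‖,
    fun s ha hb ↦ ?_⟩
  have : completedRiemannZeta₀ s = mellin P.f_modif (s / 2) / 2 := rfl
  rw [this, norm_div]
  have h2 : (s / 2).re = s.re / 2 := by simp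
  exact div_le_div_of_nonneg_right (norm_mellin_le (a := a / 2) (b := b / 2) hc
    (by rw [h2]; linarith) (by rw [h2]; linarith)) (norm_nonneg _)

lemma exists_norm_riemannXi_le (a b : ℝ) :
    ∃ C, 1 ≤ C ∧ ∀ s : ℂ, a ≤ s.re → s.re ≤ b → ‖riemannXi s‖ ≤ C * (1 + |s.im|) ^ 2 := by
  obtain ⟨C, hC⟩ := exists_norm_completedRiemannZeta₀_le a b
  set A := max |a| |b| + 1
  have hA : 1 ≤ A := by have := (abs_nonneg a).trans (le_max_left |a| |b|); simp only [A]; linarith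
  have hAC : 0 ≤ A ^ 2 * |C| := by positivity
  refine ⟨A ^ 2 * |C| + 1, by linarith, fun s ha hb ↦ ?_⟩
  have hre : |s.re| ≤ A - 1 := by
    simp only [A, add_sub_cancel_right]; exact abs_le_max_abs_abs ha hb
  have h1 : ‖s‖ ≤ A * (1 + |s.im|) := by
    have := norm_le_abs_re_add_abs_im s
    nlinarith [abs_nonneg s.im]
  have h2 : ‖s - 1‖ ≤ A * (1 + |s.im|) := by
    have := norm_sub_le s 1
    have h3 := norm_le_abs_re_add_abs_im s
    rw [norm_one] at this
    nlinarith [abs_nonneg s.im]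
  have h3 : ‖completedRiemannZeta₀ s‖ ≤ |C| := (hC s ha hb).trans (le_abs_self C)
  calc ‖riemannXi s‖ ≤ ‖s‖ * ‖s - 1‖ * ‖completedRiemannZeta₀ s‖ + 1 := by
        rw [riemannXi]; refine (norm_add_le _ _).trans ?_; simp
    _ ≤ (A * (1 + |s.im|)) * (A * (1 + |s.im|)) * |C| + 1 := by gcongr
    _ ≤ _ := by nlinarith [abs_nonneg s.im, sq_nonneg s.im]

lemma norm_riemannZeta_sub_one_le {s : ℂ} (hs : 2 ≤ s.re) :
    ‖riemannZeta s - 1‖ ≤ Real.pi ^ 2 / 6 - 1 := by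
  have h1 : 1 < s.re := by linarith
  have hsum : Summable fun n : ℕ => (1 : ℂ) / (n + 1 : ℂ) ^ s := by
    have := (summable_nat_add_iff 1).2 (Complex.summable_one_div_nat_cpow.2 h1)
    simpa using this
  have hz := hasSum_zeta_two
  have hz1 : HasSum (fun n : ℕ => (1 : ℝ) / ((n : ℝ) + 2) ^ 2) (Real.pi ^ 2 / 6 - 1) := by
    have := (hasSum_nat_add_iff' 2).2 hz
    simpa [Finset.sum_range_succ] using this
  rw [zeta_eq_tsum_one_div_nat_add_one_cpow h1, hsum.tsum_eq_zero_add]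
  simp only [Nat.cast_zero, zero_add, one_cpow, div_one, add_sub_cancel_left]
  refine tsum_of_norm_bounded hz1 fun n => ?_
  have : ((↑(n + 1) : ℂ) + 1) = ((n + 2 : ℕ) : ℂ) := by push_cast; ring
  rw [this, norm_div, norm_one, Complex.norm_natCast_cpow_of_pos (by omega)]
  refine one_div_le_one_div_of_le (by positivity) ?_
  rw [← Real.rpow_natCast]
  push_cast
  exact Real.rpow_le_rpow_of_exponent_le (by norm_cast; omega) hs

lemma one_third_le_norm_riemannZeta {s : ℂ} (hs : 2 ≤ s.re) : 1 / 3 ≤ ‖riemannZeta s‖ := by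
  have h1 := norm_riemannZeta_sub_one_le hs
  have h2 : ‖(1 : ℂ)‖ ≤ ‖riemannZeta s‖ + ‖riemannZeta s - 1‖ := by
    have := norm_sub_le (riemannZeta s) (riemannZeta s - 1)
    simpa using this
  rw [norm_one] at h2
  nlinarith [Real.pi_lt_d2, Real.pi_pos]

lemma norm_riemannZeta_le_two {s : ℂ} (hs : 2 ≤ s.re) : ‖riemannZeta s‖ ≤ 2 := by
  have h1 := norm_riemannZeta_sub_one_le hs
  have h2 : ‖riemannZeta s‖ ≤ ‖riemannZeta s - 1‖ + ‖(1 : ℂ)‖ := by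
    have := norm_add_le (riemannZeta s - 1) 1
    simpa using this
  rw [norm_one] at h2
  nlinarith [Real.pi_lt_d2, Real.pi_pos]

lemma norm_betaIntegral_le (u v : ℂ) :
    ‖betaIntegral u v‖ ≤ ‖betaIntegral u.re v.re‖ := by
  have key : ∀ a b : ℂ, ∀ x ∈ Ioo (0 : ℝ) 1,
      ‖(x : ℂ) ^ (a - 1) * (1 - (x : ℂ)) ^ (b - 1)‖ =
        x ^ (a.re - 1) * (1 - x) ^ (b.re - 1) := by
    intro a b x hx
    have : (1 - (x : ℂ)) = ((1 - x : ℝ) : ℂ) := by push_cast; ring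
    rw [norm_mul, this, norm_cpow_eq_rpow_re_of_pos hx.1,
      norm_cpow_eq_rpow_re_of_pos (by linarith [hx.2])]
    simp
  have e : betaIntegral u.re v.re =
      ((∫ x in (0 : ℝ)..1, x ^ (u.re - 1) * (1 - x) ^ (v.re - 1) : ℝ) : ℂ) := by
    rw [betaIntegral, ← intervalIntegral.integral_ofReal]
    refine intervalIntegral.integral_congr fun x hx => ?_
    rw [uIcc_of_le zero_le_one] at hx
    have : (1 - (x : ℂ)) = ((1 - x : ℝ) : ℂ) := by push_cast; ring
    simp only [this]
    rw [← ofReal_one, ← ofReal_sub, ← ofReal_sub, ← ofReal_cpow hx.1,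
      ← ofReal_cpow (by linarith [hx.2])]
    push_cast; ring
  rw [e, betaIntegral, norm_real, Real.norm_eq_abs]
  refine le_trans (intervalIntegral.norm_integral_le_integral_norm zero_le_one)
    (le_of_eq_of_le ?_ (le_abs_self _))
  rw [intervalIntegral.integral_of_le zero_le_one, intervalIntegral.integral_of_le zero_le_one,
    integral_Ioc_eq_integral_Ioo, integral_Ioc_eq_integral_Ioo]
  exact setIntegral_congr_fun measurableSet_Ioo fun x hx => key u v x hx

/-- Shifting the argument of `Γ` by a positive real shrinks the ratio fastest on the real line. -/
lemma norm_Gamma_mul_Gamma_add_le {u : ℂ} (hu : 0 < u.re) {h : ℝ} (hh : 0 < h) :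
    ‖Complex.Gamma u‖ * Real.Gamma (u.re + h) ≤ Real.Gamma u.re * ‖Complex.Gamma (u + h)‖ := by
  have h1 := Complex.Gamma_mul_Gamma_eq_betaIntegral hu (t := (h : ℂ)) (by simpa using hh)
  have h2 := Complex.Gamma_mul_Gamma_eq_betaIntegral (s := (u.re : ℂ)) (t := (h : ℂ))
    (by simpa using hu) (by simpa using hh)
  have h3 := norm_betaIntegral_le u (h : ℂ)
  rw [ofReal_re] at h3
  have h1' := congrArg norm h1
  have h2' := congrArg norm h2
  rw [norm_mul, norm_mul] at h1' h2'
  rw [← ofReal_add] at h2'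
  simp only [Complex.Gamma_ofReal, norm_real, Real.norm_eq_abs] at h1' h2'
  have g1 := Real.Gamma_pos_of_pos hh
  have g2 := Real.Gamma_pos_of_pos hu
  have g3 := Real.Gamma_pos_of_pos (add_pos hu hh)
  rw [abs_of_pos g1] at h1' h2'
  rw [abs_of_pos g2, abs_of_pos g3] at h2'
  refine le_of_mul_le_mul_right ?_ g1
  calc ‖Complex.Gamma u‖ * Real.Gamma (u.re + h) * Real.Gamma h
      = ‖Complex.Gamma (u + h)‖ * Real.Gamma (u.re + h) * ‖betaIntegral u h‖ := by
        linear_combination Real.Gamma (u.re + h) * h1'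
    _ ≤ ‖Complex.Gamma (u + h)‖ * Real.Gamma (u.re + h) * ‖betaIntegral u.re h‖ := by
        gcongr
    _ = _ := by linear_combination -‖Complex.Gamma (u + h)‖ * h2'

lemma Gamma_le_Gamma_add_mul_rpow {σ h : ℝ} (hσ : 1 < σ) (hh : 0 < h) (h1 : h < 1) :
    Real.Gamma σ ≤ Real.Gamma (σ + h) * (σ + h - 1) ^ (-h) := by
  have hp : 0 < σ + h - 1 := by linarith
  have := Real.Gamma_mul_add_mul_le_rpow_Gamma_mul_rpow_Gamma (s := σ + h) (t := σ + h - 1)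
    (a := 1 - h) (b := h) (by linarith) hp (by linarith) hh (by ring)
  have e : (1 - h) * (σ + h) + h * (σ + h - 1) = σ := by ring
  rw [e] at this
  have g1 : 0 < Real.Gamma (σ + h) := Real.Gamma_pos_of_pos (by linarith)
  have g2 : Real.Gamma (σ + h) = (σ + h - 1) * Real.Gamma (σ + h - 1) := by
    have := Real.Gamma_add_one hp.ne'
    rwa [sub_add_cancel] at this
  have g3 : Real.Gamma (σ + h - 1) = Real.Gamma (σ + h) * (σ + h - 1) ^ (-1 : ℝ) := by
    rw [g2, Real.rpow_neg_one]; field_simp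
  refine this.trans (le_of_eq ?_)
  rw [g3, Real.mul_rpow g1.le (by positivity), ← Real.rpow_mul hp.le, ← mul_assoc,
    ← Real.rpow_add g1]
  simp

lemma norm_Gammaℝ {s : ℂ} : ‖Gammaℝ s‖ = Real.pi ^ (-s.re / 2) * ‖Complex.Gamma (s / 2)‖ := by
  rw [Gammaℝ_def, norm_mul, norm_cpow_eq_rpow_re_of_pos Real.pi_pos]
  have : (-s / 2).re = -s.re / 2 := by simp [div_eq_mul_inv]
  rw [this]

lemma norm_le_norm_of_abs_re_le {z w : ℂ} (hr : |z.re| ≤ |w.re|) (hi : z.im = w.im) :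
    ‖z‖ ≤ ‖w‖ := by
  rw [← sq_le_sq₀ (norm_nonneg _) (norm_nonneg _), ← normSq_eq_norm_sq, ← normSq_eq_norm_sq,
    normSq_apply, normSq_apply, hi]
  nlinarith [sq_le_sq.2 hr]

lemma eventually_norm_riemannXi_sub_le {h : ℝ} (hh : 0 < h) (h1 : h < 1 / 2) :
    ∀ᶠ b : ℝ in atTop, ∀ s : ℂ, s.re = b → ‖riemannXi (s - h)‖ ≤ ‖riemannXi (s + h)‖ := by
  have lim : Tendsto (fun b : ℝ => 6 * Real.pi ^ h * ((b + h) / 2 - 1) ^ (-h)) atTop (𝓝 0) := by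
    have : Tendsto (fun b : ℝ => (b + h) / 2 - 1) atTop atTop :=
      tendsto_atTop_add_const_right _ _
        ((tendsto_atTop_add_const_right _ _ tendsto_id).atTop_div_const two_pos)
    simpa using ((tendsto_rpow_neg_atTop hh).comp this).const_mul (6 * Real.pi ^ h)
  filter_upwards [lim.eventually (ge_mem_nhds one_pos), eventually_gt_atTop 4] with b hb hb4 s hs
  have r1 : (s - h).re = b - h := by simp [hs]
  have r2 : (s + h).re = b + h := by simp [hs]
  have ne1 : s - h ≠ 1 := fun e => by rw [e] at r1; simp at r1; linarith
  have ne2 : s + h ≠ 1 := fun e => by rw [e] at r2; simp at r2; linarith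
  rw [riemannXi_eq_mul_riemannZeta (by linarith) ne1,
    riemannXi_eq_mul_riemannZeta (by linarith) ne2]
  simp only [norm_mul, norm_Gammaℝ]
  have n1 : ‖s - h‖ ≤ ‖s + h‖ := norm_le_norm_of_abs_re_le
    (by rw [r1, r2, abs_of_pos, abs_of_pos] <;> linarith) (by simp)
  have n2 : ‖s - h - 1‖ ≤ ‖s + h - 1‖ := norm_le_norm_of_abs_re_le
    (by rw [sub_re _ 1, sub_re _ 1, r1, r2, abs_of_pos, abs_of_pos] <;> norm_num <;> linarith) (by simp)
  have z1 := norm_riemannZeta_le_two (s := s - h) (by linarith)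
  have z2 := one_third_le_norm_riemannZeta (s := s + h) (by linarith)
  have ur : ((s - h) / 2).re = (b - h) / 2 := by
    rw [show (s - h) / 2 = (s - h) / ((2 : ℝ) : ℂ) by norm_num, div_ofReal_re, r1]
  have g := norm_Gamma_mul_Gamma_add_le (u := (s - h) / 2) (by rw [ur]; linarith) hh
  have e : (s - h) / 2 + h = (s + h) / 2 := by ring
  rw [e, ur] at g
  have g' := Gamma_le_Gamma_add_mul_rpow (σ := (b - h) / 2) (by linarith) hh (by linarith)
  have e2 : (b - h) / 2 + h = (b + h) / 2 := by ring
  rw [e2] at g g'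
  have gp : 0 < Real.Gamma ((b + h) / 2) := Real.Gamma_pos_of_pos (by linarith)
  set q := ((b + h) / 2 - 1) ^ (-h)
  have g3 : ‖Complex.Gamma ((s - h) / 2)‖ ≤ q * ‖Complex.Gamma ((s + h) / 2)‖ := by
    refine le_of_mul_le_mul_right (g.trans ?_) gp
    calc _ ≤ Real.Gamma ((b + h) / 2) * q * ‖Complex.Gamma ((s + h) / 2)‖ := by gcongr
      _ = _ := by ring
  have hq : 0 ≤ q := by apply Real.rpow_nonneg; linarith
  have pe : Real.pi ^ (-(b - h) / 2) = Real.pi ^ h * Real.pi ^ (-(b + h) / 2) := by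
    rw [← Real.rpow_add Real.pi_pos]; congr 1; ring
  rw [r1, r2, pe]
  calc _ ≤ ‖s + h‖ * ‖s + h - 1‖ * (Real.pi ^ h * Real.pi ^ (-(b + h) / 2) *
        (q * ‖Complex.Gamma ((s + h) / 2)‖)) * 2 := by gcongr
    _ = (6 * Real.pi ^ h * q) * (‖s + h‖ * ‖s + h - 1‖ * (Real.pi ^ (-(b + h) / 2) *
        ‖Complex.Gamma ((s + h) / 2)‖) * (1 / 3)) := by ring
    _ ≤ 1 * (‖s + h‖ * ‖s + h - 1‖ * (Real.pi ^ (-(b + h) / 2) *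
        ‖Complex.Gamma ((s + h) / 2)‖) * ‖riemannZeta (s + h)‖) := by gcongr
    _ = _ := by ring

lemma exp_neg_le_norm_Gamma_half_add (y : ℝ) :
    Real.exp (-(2 * |y|)) ≤ ‖Complex.Gamma (1 / 2 + y * I)‖ := by
  have h1 := Complex.Gamma_mul_Gamma_one_sub (1 / 2 + y * I)
  have e : (1 - (1 / 2 + y * I) : ℂ) = starRingEnd ℂ (1 / 2 + y * I) := by
    simp [map_ofNat]; ring
  rw [e, Complex.Gamma_conj] at h1
  have h2 := congrArg norm h1
  rw [norm_mul, norm_conj, norm_div, norm_real, Real.norm_eq_abs, abs_of_pos Real.pi_pos] at h2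
  have hs : ‖Complex.sin (Real.pi * (1 / 2 + y * I))‖ ≤ Real.exp (Real.pi * |y|) := by
    have hn : ∀ z : ℂ, ‖Complex.sin z‖ ≤ Real.exp |z.im| := by
      intro z
      rw [Complex.sin]
      have a1 : ‖Complex.exp (-z * I)‖ ≤ Real.exp |z.im| := by
        rw [Complex.norm_exp]; simp [le_abs_self]
      have a2 : ‖Complex.exp (z * I)‖ ≤ Real.exp |z.im| := by
        rw [Complex.norm_exp]; simp [neg_le_abs]
      rw [norm_div, norm_mul, norm_I, mul_one]
      have := norm_sub_le (Complex.exp (-z * I)) (Complex.exp (z * I))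
      simp only [Complex.norm_ofNat]
      linarith
    refine (hn _).trans (le_of_eq ?_)
    simp [abs_mul, abs_of_pos Real.pi_pos]
  have hs0 : 0 < ‖Complex.sin (Real.pi * (1 / 2 + y * I))‖ := by
    by_contra hc
    have : ‖Complex.sin (Real.pi * (1 / 2 + y * I))‖ = 0 :=
      le_antisymm (not_lt.1 hc) (norm_nonneg _)
    rw [this, div_zero] at h2
    have : Complex.Gamma (1 / 2 + y * I) ≠ 0 := Complex.Gamma_ne_zero_of_re_pos (by simp)
    have := norm_pos_iff.2 this
    nlinarith
  rw [← sq_le_sq₀ (Real.exp_pos _).le (norm_nonneg _), sq ‖_‖, h2, ← Real.exp_nat_mul,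
    le_div_iff₀ hs0]
  calc _ ≤ Real.exp ((2 : ℕ) * -(2 * |y|)) * Real.exp (Real.pi * |y|) := by gcongr
    _ = Real.exp (-((4 - Real.pi) * |y|)) := by rw [← Real.exp_add]; congr 1; push_cast; ring
    _ ≤ 1 := by
        rw [Real.exp_le_one_iff]
        have := Real.pi_lt_four
        have := abs_nonneg y
        nlinarith
    _ ≤ Real.pi := by linarith [Real.pi_gt_three]

lemma exp_neg_le_norm_Gamma_natCast_add (N : ℕ) (y : ℝ) :
    (1 / 2) ^ N * Real.exp (-(2 * |y|)) ≤ ‖Complex.Gamma (N + 1 / 2 + y * I)‖ := by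
  induction N with
  | zero => simpa using exp_neg_le_norm_Gamma_half_add y
  | succ N ih =>
    have e : ((N + 1 : ℕ) + 1 / 2 + y * I : ℂ) = (N + 1 / 2 + y * I) + 1 := by push_cast; ring
    have hre : (N + 1 / 2 + y * I : ℂ).re = N + 1 / 2 := by simp
    have hne : (N + 1 / 2 + y * I : ℂ) ≠ 0 := fun h => by
      rw [h] at hre; simp at hre
      have : (0 : ℝ) ≤ N := by positivity
      linarith
    rw [e, Complex.Gamma_add_one _ hne, norm_mul]
    have : 1 / 2 ≤ ‖(N + 1 / 2 + y * I : ℂ)‖ := by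
      refine le_trans ?_ (re_le_norm _)
      rw [hre]
      have : (0 : ℝ) ≤ N := by positivity
      linarith
    calc _ = 1 / 2 * ((1 / 2) ^ N * Real.exp (-(2 * |y|))) := by ring
      _ ≤ _ := by gcongr

lemma exists_exp_neg_le_norm_riemannXi_vertical {N : ℕ} (hN : 1 ≤ N) :
    ∃ C, 0 < C ∧ ∀ t : ℝ, C * Real.exp (-|t|) ≤ ‖riemannXi (2 * N + 1 + t * I)‖ := by
  refine ⟨Real.pi ^ (-(2 * N + 1 : ℝ) / 2) * (1 / 2) ^ N * (1 / 3), by positivity, fun t => ?_⟩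
  have hN' : (1 : ℝ) ≤ N := by exact_mod_cast hN
  have hre : (2 * N + 1 + t * I : ℂ).re = 2 * N + 1 := by simp
  rw [riemannXi_eq_mul_riemannZeta (by rw [hre]; linarith) (fun e => by
    rw [e] at hre; simp at hre; linarith)]
  simp only [norm_mul, norm_Gammaℝ, hre]
  have a1 : 1 ≤ ‖(2 * N + 1 + t * I : ℂ)‖ := by
    refine le_trans ?_ (re_le_norm _); rw [hre]; linarith
  have a2 : 1 ≤ ‖(2 * N + 1 + t * I - 1 : ℂ)‖ := by
    refine le_trans ?_ (re_le_norm _); rw [sub_re, hre]; simp; linarith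
  have a3 := one_third_le_norm_riemannZeta (s := 2 * N + 1 + t * I) (by rw [hre]; linarith)
  have a4 := exp_neg_le_norm_Gamma_natCast_add N (t / 2)
  have e : ((2 * N + 1 + t * I) / 2 : ℂ) = N + 1 / 2 + ((t / 2 : ℝ) : ℂ) * I := by push_cast; ring
  have e2 : 2 * |t / 2| = |t| := by rw [abs_div]; simp; ring
  rw [e2] at a4
  rw [e]
  calc _ = 1 * 1 * (Real.pi ^ (-(2 * N + 1 : ℝ) / 2) * ((1 / 2) ^ N * Real.exp (-|t|))) *
        (1 / 3) := by ring
    _ ≤ _ := by gcongr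

/-- A nonvanishing holomorphic function on a disc that does not exceed `exp M` times its central
value is not much smaller than its central value on smaller discs. -/
lemma norm_center_mul_exp_neg_le {f : ℂ → ℂ} {R M δ : ℝ} (hM : 0 < M) (hδ : 0 < δ) (hδR : δ ≤ R)
    (hf : DifferentiableOn ℂ f (Metric.ball 0 R)) (h0 : ∀ w ∈ Metric.ball (0 : ℂ) R, f w ≠ 0)
    (hb : ∀ w ∈ Metric.ball (0 : ℂ) R, ‖f w‖ ≤ ‖f 0‖ * Real.exp M) {w : ℂ} (hw : ‖w‖ ≤ R - δ) :
    ‖f 0‖ * Real.exp (-(2 * M * R / δ)) ≤ ‖f w‖ := by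
  have hR : 0 < R := hδ.trans_le hδR
  have hd : DifferentiableOn ℂ (fun z => deriv f z / f z) (Metric.ball 0 R) :=
    (hf.deriv Metric.isOpen_ball).div hf h0
  obtain ⟨g, hg0, hg⟩ := hd.isExactOn_ball.with_val_at 0 0
  have hball0 : (0 : ℂ) ∈ Metric.ball (0 : ℂ) R := Metric.mem_ball_self hR
  have heq : ∀ z ∈ Metric.ball (0 : ℂ) R, f z = f 0 * Complex.exp (g z) := by
    have hder : ∀ z ∈ Metric.ball (0 : ℂ) R,
        HasDerivAt (fun z => f z * Complex.exp (-g z)) 0 z := by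
      intro z hz
      have h1 := (hf.differentiableAt (Metric.isOpen_ball.mem_nhds hz)).hasDerivAt
      have := h1.mul (hg z hz).neg.cexp
      refine this.congr_deriv ?_
      have := h0 z hz
      field_simp
      ring
    intro z hz
    have := (convex_ball (0 : ℂ) R).is_const_of_fderivWithin_eq_zero (𝕜 := ℂ)
      (f := fun z => f z * Complex.exp (-g z))
      (fun y hy => (hder y hy).differentiableAt.differentiableWithinAt)
      (fun y hy => by
        rw [fderivWithin_of_isOpen Metric.isOpen_ball hy]
        have := (hder y hy).hasFDerivAt.fderiv
        rw [this]; ext; simp) hball0 hz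
    simp only [hg0, neg_zero, Complex.exp_zero, mul_one] at this
    rw [this, mul_assoc, ← Complex.exp_add]; simp
  have hpos : 0 < ‖f 0‖ := norm_pos_iff.2 (h0 0 hball0)
  have hwb : w ∈ Metric.ball (0 : ℂ) R := by simp; linarith
  have hre : MapsTo g (Metric.ball 0 R) {z | z.re ≤ M} := by
    intro z hz
    have h1 := hb z hz
    rw [heq z hz, norm_mul, Complex.norm_exp] at h1
    exact Real.exp_le_exp.1 (le_of_mul_le_mul_left h1 hpos)
  have hbc := Complex.borelCaratheodory_zero hM
    (fun z hz => (hg z hz).differentiableAt.differentiableWithinAt) hre hR hwb hg0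
  rw [heq w hwb, norm_mul, Complex.norm_exp]
  gcongr
  have h2 : ‖g w‖ ≤ 2 * M * R / δ := by
    refine hbc.trans ?_
    gcongr
    · linarith
    · linarith
  linarith [abs_re_le_norm (g w), neg_abs_le (g w).re]

lemma exists_exp_neg_le_norm_riemannXi (hRH : RiemannHypothesis) {h : ℝ} (hh : 0 < h) (b : ℝ) :
    ∃ A, 0 ≤ A ∧ ∀ z : ℂ, 1 / 2 + h ≤ z.re → z.re ≤ b →
      Real.exp (-(A * (1 + |z.im|))) ≤ ‖riemannXi z‖ := by
  obtain ⟨N, hN⟩ := exists_nat_ge (|b| + h + 1)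
  have hb0 := abs_nonneg b
  have hN1 : 1 ≤ N := by
    have : (1 : ℝ) ≤ N := by linarith
    exact_mod_cast this
  obtain ⟨C₀, hC₀, hlow⟩ := exists_exp_neg_le_norm_riemannXi_vertical hN1
  set R : ℝ := 2 * N + 1 / 2 with hRdef
  have hR : 0 < R := by positivity
  have hhR : h ≤ R := by rw [hRdef]; linarith
  obtain ⟨C, hC1, hup⟩ := exists_norm_riemannXi_le (1 / 2) (2 * R + 1)
  have hC : 0 < C := by linarith
  set K : ℝ := |Real.log (C / C₀)| + 2 * R + 3
  have hK : 0 < K := by positivity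
  refine ⟨|Real.log C₀| + 1 + 2 * K * R / h, by positivity, fun z hz1 hz2 => ?_⟩
  set t := z.im with ht
  have hM : 0 < K * (1 + |t|) := by positivity
  set c : ℂ := 2 * N + 1 + t * I with hc
  have hcre : c.re = 2 * N + 1 := by simp [hc]
  have hcim : c.im = t := by simp [hc]
  have hlow' := hlow t
  rw [← hc] at hlow'
  have key := norm_center_mul_exp_neg_le (f := fun w => riemannXi (c + w)) (R := R)
    (M := K * (1 + |t|)) (δ := h) hM hh hhR
    (differentiable_riemannXi.comp (differentiable_id.const_add c)).differentiableOn
    (fun w hw => by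
      refine riemannXi_ne_zero_of_riemannHypothesis hRH ?_
      have : ‖w‖ < R := by simpa using hw
      have := abs_re_le_norm w
      have := neg_abs_le w.re
      rw [add_re, hcre]; linarith)
    (fun w hw => by
      have hwR : ‖w‖ < R := by simpa using hw
      have i1 := abs_re_le_norm w
      have i2 := abs_im_le_norm w
      have i3 := abs_le.1 i1
      refine (hup (c + w) ?_ ?_).trans ?_
      · rw [add_re, hcre]; linarith
      · rw [add_re, hcre]; linarith
      · simp only [add_zero]
        have him : |(c + w).im| ≤ |t| + R := by
          rw [add_im, hcim]
          exact (abs_add_le _ _).trans (by linarith)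
        calc C * (1 + |(c + w).im|) ^ 2 ≤ C * (1 + (|t| + R)) ^ 2 := by gcongr
          _ ≤ C * Real.exp (|t| + R) ^ 2 := by
              gcongr
              linarith [Real.add_one_le_exp (|t| + R)]
          _ = C₀ * Real.exp (-|t|) * (C / C₀ * Real.exp (2 * (|t| + R) + |t|)) := by
              rw [← Real.exp_nat_mul, mul_mul_mul_comm, ← Real.exp_add]
              field_simp
              ring_nf
          _ = C₀ * Real.exp (-|t|) * Real.exp (Real.log (C / C₀) + (2 * (|t| + R) + |t|)) := by
              rw [Real.exp_add (Real.log _), Real.exp_log (by positivity)]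
          _ ≤ _ := by
              gcongr
              have := le_abs_self (Real.log (C / C₀))
              have := abs_nonneg (Real.log (C / C₀))
              have := abs_nonneg t
              simp only [K]
              nlinarith [mul_nonneg (abs_nonneg (Real.log (C / C₀))) (abs_nonneg t),
                mul_nonneg hR.le (abs_nonneg t)])
    (w := z - c) (by
      have e : z - c = ((z.re - (2 * N + 1) : ℝ) : ℂ) := by
        apply Complex.ext <;> simp [hc, ht]
      rw [e, norm_real, Real.norm_eq_abs, abs_of_nonpos]
      · rw [hRdef]; linarith
      · linarith [le_abs_self b])
  simp only [add_zero, add_sub_cancel] at key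
  refine le_trans ?_ ((mul_le_mul_of_nonneg_right hlow' (Real.exp_pos _).le).trans key)
  conv_rhs => rw [← Real.exp_log hC₀]
  rw [← Real.exp_add, ← Real.exp_add]
  gcongr
  have h1 := neg_abs_le (Real.log C₀)
  have h2 : 0 ≤ |Real.log C₀| * |t| := by positivity
  have e : 2 * (K * (1 + |t|)) * R / h = 2 * K * R / h * (1 + |t|) := by ring
  rw [e]
  nlinarith [abs_nonneg t]

lemma exists_mul_exp_le_exp_mul_exp {A C c : ℝ} (hA : 0 ≤ A) (hC : 1 ≤ C) (hc : 0 < c) :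
    ∃ B : ℝ, ∀ u : ℝ, 0 ≤ u →
      C * (1 + u) ^ 2 * Real.exp (A * (1 + u)) ≤ Real.exp (B * Real.exp (c * u)) := by
  refine ⟨(Real.log C + (A + 2)) + (A + 2) / c, fun u hu => ?_⟩
  have hl : 0 ≤ Real.log C := Real.log_nonneg hC
  calc C * (1 + u) ^ 2 * Real.exp (A * (1 + u))
      ≤ Real.exp (Real.log C) * Real.exp u ^ 2 * Real.exp (A * (1 + u)) := by
        rw [Real.exp_log (by linarith)]
        gcongr
        linarith [Real.add_one_le_exp u]
    _ = Real.exp (Real.log C + 2 * u + A * (1 + u)) := by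
        rw [← Real.exp_nat_mul, ← Real.exp_add, ← Real.exp_add]; norm_num
    _ ≤ _ := by
        gcongr
        have h1 : c * u + 1 ≤ Real.exp (c * u) := Real.add_one_le_exp _
        have h2 : u ≤ Real.exp (c * u) / c := by
          rw [le_div_iff₀ hc]; linarith
        have h3 : 1 ≤ Real.exp (c * u) := by
          have := mul_nonneg hc.le hu
          linarith
        have e : (Real.log C + (A + 2) + (A + 2) / c) * Real.exp (c * u) =
          (Real.log C + (A + 2)) * Real.exp (c * u) + (A + 2) * (Real.exp (c * u) / c) := by ring
        rw [e]
        have h4 : (A + 2) * u ≤ (A + 2) * (Real.exp (c * u) / c) := by gcongr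
        have h5 : (Real.log C + (A + 2)) * 1 ≤ (Real.log C + (A + 2)) * Real.exp (c * u) := by
          gcongr
        nlinarith

lemma norm_riemannXi_sub_le (hRH : RiemannHypothesis) {h : ℝ} (hh : 0 < h) (h1 : h < 1 / 2)
    {s : ℂ} (hs : 1 / 2 ≤ s.re) : ‖riemannXi (s - h)‖ ≤ ‖riemannXi (s + h)‖ := by
  obtain ⟨b, hb, hbs, hb1⟩ := ((eventually_norm_riemannXi_sub_le hh h1).and
    ((eventually_ge_atTop s.re).and (eventually_gt_atTop 1))).exists
  have hne : ∀ z : ℂ, 1 / 2 ≤ z.re → riemannXi (z + h) ≠ 0 := fun z hz =>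
    riemannXi_ne_zero_of_riemannHypothesis hRH (by rw [add_re, ofReal_re]; linarith)
  suffices H : ‖riemannXi (s - h) / riemannXi (s + h)‖ ≤ 1 by
    rwa [norm_div, div_le_one (norm_pos_iff.2 (hne s hs))] at H
  have hξ := differentiable_riemannXi
  refine PhragmenLindelof.vertical_strip (a := 1 / 2) (b := b)
    (f := fun z => riemannXi (z - h) / riemannXi (z + h)) ?_ ?_ ?_ ?_ hs hbs
  · refine DifferentiableOn.diffContOnCl fun z hz => ?_
    have hz' : 1 / 2 ≤ z.re := by
      have : closure (re ⁻¹' Ioo (1 / 2) b) ⊆ re ⁻¹' Icc (1 / 2) b :=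
        closure_minimal (preimage_mono Ioo_subset_Icc_self) (isClosed_Icc.preimage continuous_re)
      exact (this hz).1
    have := hne z hz'
    have d1 : DifferentiableAt ℂ (fun z => riemannXi (z - h)) z :=
      (hξ (z - h)).comp z (differentiableAt_id.sub_const _)
    have d2 : DifferentiableAt ℂ (fun z => riemannXi (z + h)) z :=
      (hξ (z + h)).comp z (differentiableAt_id.add_const _)
    exact (d1.div d2 this).differentiableWithinAt
  · obtain ⟨C, hC1, hC⟩ := exists_norm_riemannXi_le (1 / 2 - h) b
    obtain ⟨A, hA0, hA⟩ := exists_exp_neg_le_norm_riemannXi hRH hh (b + h)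
    have hcpos : 0 < Real.pi / (b - 1 / 2) := div_pos Real.pi_pos (by linarith)
    obtain ⟨B, hB⟩ := exists_mul_exp_le_exp_mul_exp hA0 hC1 (half_pos hcpos)
    refine ⟨Real.pi / (b - 1 / 2) / 2, half_lt_self hcpos, B, ?_⟩
    refine Asymptotics.IsBigO.of_bound 1 ?_
    refine Filter.Eventually.filter_mono inf_le_right ?_
    rw [eventually_principal]
    intro z hz
    rw [one_mul, Real.norm_eq_abs, Real.abs_exp, norm_div, div_eq_mul_inv]
    refine le_trans ?_ (hB |z.im| (abs_nonneg _))
    have hz1 := hz.1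
    have hz2 := hz.2
    have u1 := hC (z - h) (by simp; linarith) (by simp; linarith)
    have u2 := hA (z + h) (by simp; linarith) (by simp; linarith)
    simp only [sub_im, add_im, ofReal_im, sub_zero, add_zero] at u1 u2
    have u3 : ‖riemannXi (z + h)‖⁻¹ ≤ Real.exp (A * (1 + |z.im|)) := by
      rw [← neg_neg (A * (1 + |z.im|)), Real.exp_neg]
      exact inv_anti₀ (Real.exp_pos _) u2
    gcongr
  · intro z hz
    have e : z - h = 1 - starRingEnd ℂ (z + h) := by
      apply Complex.ext
      · simp [hz]; ring
      · simp
    rw [norm_div, e, riemannXi_one_sub, riemannXi_conj (by simp [hz]; linarith), norm_conj]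
    exact div_self_le_one _
  · intro z hz
    rw [norm_div]
    exact div_le_one_of_le₀ (hb z hz) (norm_nonneg _)

/-- Under the Riemann hypothesis `ξ'/ξ` has nonnegative real part right of the critical line. -/
lemma re_logDeriv_riemannXi_nonneg (hRH : RiemannHypothesis) {s : ℂ} (hs : 1 / 2 < s.re) :
    0 ≤ (logDeriv riemannXi s).re := by
  have hξ := differentiable_riemannXi
  have hne := riemannXi_ne_zero_of_riemannHypothesis hRH hs
  set N : ℝ → ℝ := fun h => ‖riemannXi (s + h)‖ ^ 2 with hN
  have hderiv : HasDerivAt N (2 * inner ℝ (riemannXi s) (deriv riemannXi s)) 0 := by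
    have h1 : HasDerivAt (fun h : ℝ => riemannXi (s + h)) (deriv riemannXi s) 0 := by
      have := (hξ (s + (0 : ℝ))).hasDerivAt.comp_const_add s ((0 : ℝ) : ℂ)
      simpa using this.comp_ofReal
    simpa using h1.norm_sq
  have hderiv2 : HasDerivAt (fun h => N h - N (-h))
      (4 * inner ℝ (riemannXi s) (deriv riemannXi s)) 0 := by
    have h2 : HasDerivAt (fun h => N (-h)) (-(2 * inner ℝ (riemannXi s) (deriv riemannXi s))) 0 := by
      have hd : HasDerivAt N (2 * inner ℝ (riemannXi s) (deriv riemannXi s)) (-0) := by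
        simpa using hderiv
      exact (hd.comp (0 : ℝ) (hasDerivAt_neg 0)).congr_deriv (by ring)
    exact (hderiv.sub h2).congr_deriv (by ring)
  have hge : 0 ≤ 4 * inner ℝ (riemannXi s) (deriv riemannXi s) := by
    have ht := (hderiv2.tendsto_slope).mono_left (nhdsGT_le_nhdsNE 0)
    refine ge_of_tendsto ht ?_
    filter_upwards [Ioo_mem_nhdsGT (show (0 : ℝ) < 1 / 2 by norm_num)] with h hh
    rw [slope_def_field]
    refine div_nonneg ?_ (by linarith [hh.1])
    have := norm_riemannXi_sub_le hRH hh.1 hh.2 hs.le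
    simp only [hN, ofReal_neg, ofReal_zero, neg_zero, sub_self, sub_zero, ← sub_eq_add_neg]
    have := pow_le_pow_left₀ (norm_nonneg _) this 2
    linarith
  have e : (logDeriv riemannXi s).re =
      inner ℝ (riemannXi s) (deriv riemannXi s) / ‖riemannXi s‖ ^ 2 := by
    rw [logDeriv_apply, div_re, Complex.inner, mul_re, conj_re, conj_im, ← normSq_eq_norm_sq]
    ring
  rw [e]
  exact div_nonneg (by linarith) (by positivity)

lemma integral_cpow_sub_of_re {s : ℝ} (hs : 1 < s) {ρ : ℂ} (hρ : ρ.re = 1 / 2) :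
    ∫ y in (0 : ℝ)..1, ((y ^ (s - 1) : ℝ) : ℂ) * (y : ℂ) ^ (-ρ) = 1 / (s - ρ) := by
  have hre : -1 < ((s - 1 : ℝ) - ρ : ℂ).re := by
    rw [sub_re, ofReal_re, hρ]; linarith
  have h := integral_cpow (a := 0) (b := 1) (r := (s - 1 : ℝ) - ρ) (Or.inl hre)
  have hne : ((s - 1 : ℝ) - ρ + 1 : ℂ) ≠ 0 := by
    intro h0
    have := congrArg re h0
    simp [hρ] at this
    linarith
  rw [ofReal_zero, ofReal_one, one_cpow, zero_cpow hne, sub_zero] at h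
  rw [show (s : ℂ) - ρ = (s - 1 : ℝ) - ρ + 1 by push_cast; ring, ← h]
  rw [intervalIntegral.integral_of_le zero_le_one, intervalIntegral.integral_of_le zero_le_one]
  refine setIntegral_congr_fun measurableSet_Ioc fun y hy => ?_
  have : (y : ℂ) ≠ 0 := by exact_mod_cast hy.1.ne'
  simp only [ofReal_cpow hy.1.le]
  rw [← cpow_add _ _ this, ← sub_eq_add_neg]

/-- The deviation of the Herglotz kernel from its value at `e = 1`, as an integral over powers. -/
lemma abs_sum_re_kernel_le {ι : Type*} (t : Finset ι) (c s : ι → ℝ) (hs : ∀ i ∈ t, 1 < s i)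
    {e : ℂ} (he : ‖e‖ = 1) :
    |∑ i ∈ t, c i * (2 * (1 - e) / (s i * (1 - e) - 1)).re| ≤
      2 * ∫ y in (0 : ℝ)..1, |∑ i ∈ t, c i * y ^ (s i - 1)| * y ^ (-(1 / 2) : ℝ) := by
  have hJ : 0 ≤ ∫ y in (0 : ℝ)..1, |∑ i ∈ t, c i * y ^ (s i - 1)| * y ^ (-(1 / 2) : ℝ) := by
    refine intervalIntegral.integral_nonneg zero_le_one fun y hy => ?_
    exact mul_nonneg (abs_nonneg _) (Real.rpow_nonneg hy.1 _)
  rcases eq_or_ne e 1 with rfl | he1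
  · simpa using hJ
  have hne : 1 - e ≠ 0 := sub_ne_zero.2 he1.symm
  set ρ : ℂ := 1 / (1 - e) with hρdef
  have hρ : ρ.re = 1 / 2 := by
    have h1 : e.re ^ 2 + e.im ^ 2 = 1 := by
      have := Complex.sq_norm e
      rw [he, normSq_apply] at this
      linarith
    have h2 : e.re ≠ 1 := fun h => he1 (by
      apply Complex.ext
      · simpa using h
      · rw [h] at h1
        have : e.im ^ 2 = 0 := by linarith
        simpa using this)
    have h3 : normSq (1 - e) = 2 * (1 - e.re) := by
      rw [normSq_apply]; simp; linear_combination h1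
    rw [hρdef, one_div, inv_re, h3]
    have : 1 - e.re ≠ 0 := fun h => h2 (by linarith)
    simp; field_simp
  have hker : ∀ i ∈ t, 2 * (1 - e) / (s i * (1 - e) - 1) =
      2 * ∫ y in (0 : ℝ)..1, ((y ^ (s i - 1) : ℝ) : ℂ) * (y : ℂ) ^ (-ρ) := by
    intro i hi
    rw [integral_cpow_sub_of_re (hs i hi) hρ]
    have hd : (s i : ℂ) - ρ ≠ 0 := by
      intro h0
      have := congrArg re h0
      simp [hρ] at this
      linarith [hs i hi]
    have : (s i : ℂ) * (1 - e) - 1 = (1 - e) * (s i - ρ) := by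
      rw [hρdef]; field_simp
    rw [this]; field_simp
  have hint : ∀ i ∈ t, IntervalIntegrable
      (fun y : ℝ => (c i : ℂ) * (((y ^ (s i - 1) : ℝ) : ℂ) * (y : ℂ) ^ (-ρ))) volume 0 1 := by
    intro i hi
    have hre : -1 < ((s i - 1 : ℝ) - ρ : ℂ).re := by
      rw [sub_re, ofReal_re, hρ]; linarith [hs i hi]
    have := (intervalIntegral.intervalIntegrable_cpow' (a := 0) (b := 1) hre).const_mul (c i : ℂ)
    refine this.congr ?_
    rw [uIoc_of_le zero_le_one]
    intro y hy
    have h0 : (y : ℂ) ≠ 0 := by exact_mod_cast hy.1.ne'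
    simp only [ofReal_cpow hy.1.le]
    rw [← cpow_add _ _ h0, ← sub_eq_add_neg]
  have hsum : ∑ i ∈ t, (c i : ℂ) * (2 * (1 - e) / (s i * (1 - e) - 1)) =
      2 * ∫ y in (0 : ℝ)..1, ((∑ i ∈ t, c i * y ^ (s i - 1) : ℝ) : ℂ) * (y : ℂ) ^ (-ρ) := by
    have : (fun y : ℝ => ((∑ i ∈ t, c i * y ^ (s i - 1) : ℝ) : ℂ) * (y : ℂ) ^ (-ρ)) =
        fun y : ℝ => ∑ i ∈ t, (c i : ℂ) * (((y ^ (s i - 1) : ℝ) : ℂ) * (y : ℂ) ^ (-ρ)) := by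
      funext y
      push_cast
      rw [Finset.sum_mul]
      simp only [mul_assoc]
    rw [this, intervalIntegral.integral_finsetSum hint, Finset.mul_sum]
    refine Finset.sum_congr rfl fun i hi => ?_
    rw [hker i hi, intervalIntegral.integral_const_mul]
    ring
  have hre : ∑ i ∈ t, c i * (2 * (1 - e) / (s i * (1 - e) - 1)).re =
      (∑ i ∈ t, (c i : ℂ) * (2 * (1 - e) / (s i * (1 - e) - 1))).re := by
    rw [re_sum]
    exact Finset.sum_congr rfl fun i _ => (re_ofReal_mul _ _).symm
  rw [hre, hsum]
  refine (abs_re_le_norm _).trans ?_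
  rw [norm_mul, Complex.norm_ofNat]
  gcongr
  refine (intervalIntegral.norm_integral_le_integral_norm zero_le_one).trans (le_of_eq ?_)
  rw [intervalIntegral.integral_of_le zero_le_one, intervalIntegral.integral_of_le zero_le_one]
  refine setIntegral_congr_fun measurableSet_Ioc fun y hy => ?_
  rw [norm_mul, norm_real, Real.norm_eq_abs, norm_cpow_eq_rpow_re_of_pos hy.1, neg_re, hρ]

lemma abs_sum_re_sub_le_of_harmonic {ι : Type*} (t : Finset ι) (c s : ι → ℝ)
    (hs : ∀ i ∈ t, 1 < s i) {u : ℂ → ℝ}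
    (hu : InnerProductSpace.HarmonicOnNhd u (Metric.closedBall 0 1))
    (hpos : ∀ e, ‖e‖ = 1 → 0 ≤ u e) :
    |∑ i ∈ t, c i * ((u ((1 - 1 / s i : ℝ) : ℂ) - (2 * s i - 1) * u 0) / (s i * (1 - s i)))| ≤
      2 * (∫ y in (0 : ℝ)..1, |∑ i ∈ t, c i * y ^ (s i - 1)| * y ^ (-(1 / 2) : ℝ)) * u 0 := by
  set J := ∫ y in (0 : ℝ)..1, |∑ i ∈ t, c i * y ^ (s i - 1)| * y ^ (-(1 / 2) : ℝ)
  have hucont : ContinuousOn u (Metric.sphere 0 |1|) := by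
    intro x hx
    rw [abs_one] at hx
    exact ((hu x (Metric.sphere_subset_closedBall hx)).1.continuousAt).continuousWithinAt
  have hui : CircleIntegrable u 0 1 := hucont.circleIntegrable'
  have hball : ∀ i ∈ t, ((1 - 1 / s i : ℝ) : ℂ) ∈ Metric.ball (0 : ℂ) 1 := by
    intro i hi
    have := hs i hi
    have h1 : 1 / s i < 1 := by rw [div_lt_one] <;> linarith
    have h2 : 0 < 1 / s i := by apply one_div_pos.2; linarith
    rw [mem_ball_zero_iff, norm_real, Real.norm_eq_abs, abs_of_pos] <;> linarith
  set k : ι → ℂ → ℝ := fun i => (re ∘ herglotzRieszKernel 0 ((1 - 1 / s i : ℝ) : ℂ)) • u with hk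
  have hki : ∀ i ∈ t, CircleIntegrable (k i) 0 1 := by
    intro i hi
    refine ContinuousOn.circleIntegrable' ?_
    refine ContinuousOn.smul ?_ hucont
    have := continuousOn_herglotzRieszKernel_sphere (hball i hi)
    exact continuous_re.comp_continuousOn this
  have hP : ∀ i ∈ t, Real.circleAverage (k i) 0 1 = u ((1 - 1 / s i : ℝ) : ℂ) := fun i hi =>
    InnerProductSpace.HarmonicOnNhd.circleAverage_re_herglotzRieszKernel_smul hu (hball i hi)
  have hM : Real.circleAverage u 0 1 = u 0 :=
    InnerProductSpace.HarmonicOnNhd.circleAverage_eq (by rwa [abs_one])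
  set a : ι → ℝ := fun i => c i / (s i * (1 - s i))
  set g : ι → ℂ → ℝ := fun i => a i • (k i - (2 * s i - 1) • u) with hg
  have hgi : ∀ i ∈ t, CircleIntegrable (g i) 0 1 := fun i hi =>
    ((hki i hi).sub (hui.const_smul)).const_smul
  have hgavg : Real.circleAverage (∑ i ∈ t, g i) 0 1 =
      ∑ i ∈ t, c i * ((u ((1 - 1 / s i : ℝ) : ℂ) - (2 * s i - 1) * u 0) / (s i * (1 - s i))) := by
    rw [Real.circleAverage_sum hgi]
    refine Finset.sum_congr rfl fun i hi => ?_
    rw [hg, Real.circleAverage_smul, Real.circleAverage_sub (hki i hi) hui.const_smul,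
      Real.circleAverage_smul, hP i hi, hM]
    simp only [a, smul_eq_mul]
    ring
  have hsumi : CircleIntegrable (∑ i ∈ t, g i) 0 1 := CircleIntegrable.sum t hgi
  rw [← hgavg]
  refine Real.abs_circleAverage_le_circleAverage_abs.trans ?_
  have : Real.circleAverage ((2 * J) • u) 0 1 = 2 * J * u 0 := by
    rw [Real.circleAverage_smul, hM, smul_eq_mul]
  rw [← this]
  refine Real.circleAverage_mono hsumi.abs hui.const_smul fun e he => ?_
  have he1 : ‖e‖ = 1 := by simpa using he
  have hpt : (∑ i ∈ t, g i) e =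
      (∑ i ∈ t, c i * (2 * (1 - e) / (s i * (1 - e) - 1)).re) * u e := by
    rw [Finset.sum_apply, Finset.sum_mul]
    refine Finset.sum_congr rfl fun i hi => ?_
    have hsi := hs i hi
    have hs0 : (s i : ℂ) ≠ 0 := by exact_mod_cast (by linarith : s i ≠ 0)
    have hden : (s i : ℂ) * (1 - e) - 1 ≠ 0 := by
      intro h0
      have h1 : e = ((1 - 1 / s i : ℝ) : ℂ) := by
        push_cast; field_simp; linear_combination -h0
      have := hball i hi
      rw [← h1, mem_ball_zero_iff, he1] at this
      exact lt_irrefl _ this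
    have hkern : herglotzRieszKernel 0 ((1 - 1 / s i : ℝ) : ℂ) e =
        ((2 * s i - 1 : ℝ) : ℂ) +
          ((s i * (1 - s i) : ℝ) : ℂ) * (2 * (1 - e) / (s i * (1 - e) - 1)) := by
      rw [herglotzRieszKernel_def]
      have hd2 : e - 0 - (((1 - 1 / s i : ℝ) : ℂ) - 0) = -(s i * (1 - e) - 1) / s i := by
        push_cast; field_simp; ring
      rw [hd2]
      have : -((s i : ℂ) * (1 - e) - 1) ≠ 0 := neg_ne_zero.2 hden
      push_cast
      field_simp
      ring
    have hre := congrArg re hkern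
    rw [add_re, re_ofReal_mul, ofReal_re] at hre
    simp only [hg, hk, a, Pi.smul_apply, Pi.sub_apply, Pi.mul_apply, Function.comp_apply, smul_eq_mul]
    rw [hre]
    have h0 : s i ≠ 0 := by linarith
    have h1 : 1 - s i ≠ 0 := by linarith
    generalize (2 * (1 - e) / ((s i : ℂ) * (1 - e) - 1)).re = q
    field_simp
    ring
  simp only [Pi.abs_apply, Pi.smul_apply, smul_eq_mul]
  rw [hpt, abs_mul, abs_of_nonneg (hpos e he1)]
  exact mul_le_mul_of_nonneg_right (abs_sum_re_kernel_le t c s hs he1) (hpos e he1)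

lemma half_lt_re_one_div_one_sub {w : ℂ} (hw : ‖w‖ < 1) : 1 / 2 < (1 / (1 - w)).re := by
  have h1 : w.re ^ 2 + w.im ^ 2 < 1 := by
    have := Complex.sq_norm w
    rw [normSq_apply] at this
    nlinarith [norm_nonneg w]
  have hpos : 0 < normSq (1 - w) := by
    rw [normSq_pos]
    intro h
    rw [sub_eq_zero] at h
    rw [← h, norm_one] at hw
    exact lt_irrefl _ hw
  rw [one_div (1 - w), inv_re, lt_div_iff₀ hpos, normSq_apply]
  simp
  nlinarith

lemma analyticAt_logDeriv_riemannXi (hRH : RiemannHypothesis) {s : ℂ} (hs : 1 / 2 < s.re) :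
    AnalyticAt ℂ (logDeriv riemannXi) s := by
  have h := differentiable_riemannXi.analyticAt s
  exact h.deriv.div h (riemannXi_ne_zero_of_riemannHypothesis hRH hs)

lemma logDeriv_riemannXi_one :
    logDeriv riemannXi 1 = (Real.eulerMascheroniConstant - Real.log (4 * Real.pi)) / 2 + 1 := by
  have h : HasDerivAt riemannXi (completedRiemannZeta₀ 1) 1 := by
    have h1 := (((hasDerivAt_id (1 : ℂ)).mul ((hasDerivAt_id (1 : ℂ)).sub_const 1)).mul
      (differentiable_completedZeta₀ 1).hasDerivAt).add_const 1
    exact h1.congr_deriv (by simp)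
  rw [logDeriv_apply, h.deriv, riemannXi_one, div_one, completedRiemannZeta₀_one]
  rw [Complex.ofReal_log (by positivity)]
  push_cast
  rfl

/-- The Herglotz representation of `ξ'/ξ` in integrated form, at real points `s i > 1`. -/
lemma abs_sum_logDeriv_riemannXi_le (hRH : RiemannHypothesis) {ι : Type*} (t : Finset ι)
    (c s : ι → ℝ) (hs : ∀ i ∈ t, 1 < s i) :
    |∑ i ∈ t, c i * (((logDeriv riemannXi (s i)).re -
        (2 * s i - 1) * (logDeriv riemannXi 1).re) / (s i * (1 - s i)))| ≤
      2 * (∫ y in (0 : ℝ)..1, |∑ i ∈ t, c i * y ^ (s i - 1)| * y ^ (-(1 / 2) : ℝ)) *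
        (logDeriv riemannXi 1).re := by
  set J := ∫ y in (0 : ℝ)..1, |∑ i ∈ t, c i * y ^ (s i - 1)| * y ^ (-(1 / 2) : ℝ)
  set P := logDeriv riemannXi with hPdef
  have hlt : ∀ r ∈ Ioo (0 : ℝ) 1, ∀ z : ℂ, ‖z‖ ≤ 1 → 1 / 2 < (1 / (1 - r * z)).re := by
    intro r hr z hz
    apply half_lt_re_one_div_one_sub
    rw [norm_mul, norm_real, Real.norm_eq_abs, abs_of_pos hr.1]
    nlinarith [hr.1, hr.2, norm_nonneg z]
  have key : ∀ r ∈ Ioo (0 : ℝ) 1,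
      |∑ i ∈ t, c i * (((P (1 / (1 - r * ((1 - 1 / s i : ℝ) : ℂ)))).re -
        (2 * s i - 1) * (P 1).re) / (s i * (1 - s i)))| ≤ 2 * J * (P 1).re := by
    intro r hr
    have := abs_sum_re_sub_le_of_harmonic t c s hs (u := fun z => (P (1 / (1 - r * z))).re)
      (fun z hz => by
        have hz' : ‖z‖ ≤ 1 := by simpa using hz
        have h1 := hlt r hr z hz'
        have hne : (1 - r * z : ℂ) ≠ 0 := by
          intro h; rw [h] at h1; norm_num at h1
        have h2 : AnalyticAt ℂ (fun z : ℂ => 1 / (1 - r * z)) z := by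
          fun_prop (disch := assumption)
        exact (AnalyticAt.fun_comp (g := P) (f := fun z : ℂ => 1 / (1 - r * z))
          (analyticAt_logDeriv_riemannXi hRH h1) h2).harmonicAt_re)
      (fun e he => re_logDeriv_riemannXi_nonneg hRH (hlt r hr e he.le))
    simp only [mul_zero, sub_zero, div_one] at this
    exact this
  have lim : Tendsto (fun r : ℝ => |∑ i ∈ t, c i * (((P (1 / (1 - r * ((1 - 1 / s i : ℝ) : ℂ)))).re -
        (2 * s i - 1) * (P 1).re) / (s i * (1 - s i)))|) (𝓝[<] 1)
      (𝓝 |∑ i ∈ t, c i * (((P (s i)).re - (2 * s i - 1) * (P 1).re) / (s i * (1 - s i)))|) := by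
    refine (tendsto_finsetSum _ fun i hi => ?_).abs
    refine (((Tendsto.sub_const ?_ _).div_const _).const_mul _)
    have hsi := hs i hi
    have hs0 : (s i : ℂ) ≠ 0 := by exact_mod_cast (by linarith : s i ≠ 0)
    have e1 : (1 / (1 - (1 : ℝ) * ((1 - 1 / s i : ℝ) : ℂ)) : ℂ) = s i := by
      push_cast; field_simp; simp
    have hc : ContinuousAt P (1 / (1 - (1 : ℝ) * ((1 - 1 / s i : ℝ) : ℂ))) := by
      rw [e1]
      exact (analyticAt_logDeriv_riemannXi hRH (by rw [ofReal_re]; linarith)).continuousAt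
    have hc2 : ContinuousAt (fun r : ℝ => (1 / (1 - r * ((1 - 1 / s i : ℝ) : ℂ)) : ℂ)) 1 := by
      have : (1 - (1 : ℝ) * ((1 - 1 / s i : ℝ) : ℂ)) ≠ 0 := by
        intro h; rw [h, div_zero] at e1; exact hs0 e1.symm
      fun_prop (disch := assumption)
    have h3 := (continuous_re.continuousAt.comp (ContinuousAt.comp
      (f := fun r : ℝ => (1 / (1 - r * ((1 - 1 / s i : ℝ) : ℂ)) : ℂ)) hc hc2)).tendsto
    simp only [Function.comp_apply, e1] at h3
    exact h3.mono_left nhdsWithin_le_nhds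
  refine le_of_tendsto lim ?_
  filter_upwards [Ioo_mem_nhdsLT (show (0 : ℝ) < 1 by norm_num)] with r hr using key r hr

lemma logDeriv_Gammaℝ_two_mul_nat_add_two (n : ℕ) :
    DifferentiableAt ℂ Gammaℝ (2 * n + 2) ∧ logDeriv Gammaℝ (2 * n + 2) =
      (-Real.log Real.pi - Real.eulerMascheroniConstant + harmonic n) / 2 := by
  have hpi : (Real.pi : ℂ) ≠ 0 := by exact_mod_cast Real.pi_ne_zero
  have e : (2 * n + 2 : ℂ) / 2 = n + 1 := by ring
  have hg0 : HasDerivAt (fun s : ℂ => s / 2) (1 / 2) (2 * n + 2 : ℂ) := (hasDerivAt_id _).div_const 2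
  have hG : HasDerivAt (fun s : ℂ => Complex.Gamma (s / 2))
      (n.factorial * (-Real.eulerMascheroniConstant + harmonic n) * (1 / 2)) (2 * n + 2) := by
    refine HasDerivAt.comp (2 * n + 2 : ℂ) (h₂ := Complex.Gamma) ?_ hg0
    rw [e]; exact Complex.hasDerivAt_Gamma_nat n
  have hP : HasDerivAt (fun s : ℂ => (Real.pi : ℂ) ^ (-s / 2))
      ((Real.pi : ℂ) ^ (-(2 * n + 2 : ℂ) / 2) * Complex.log Real.pi * (-1 / 2)) (2 * n + 2) := by
    have : HasDerivAt (fun s : ℂ => -s / 2) (-1 / 2) (2 * n + 2 : ℂ) :=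
      (hasDerivAt_id _).neg.div_const 2
    exact this.const_cpow (Or.inl hpi)
  have hm := hP.mul hG
  have hfun : (fun s : ℂ => (Real.pi : ℂ) ^ (-s / 2)) * (fun s : ℂ => Complex.Gamma (s / 2)) =
        Gammaℝ := by
    ext s; simp [Gammaℝ_def]
  rw [hfun] at hm
  refine ⟨hm.differentiableAt, ?_⟩
  rw [logDeriv_apply, hm.deriv, Gammaℝ_def, e, Complex.Gamma_nat_eq_factorial]
  have hf : (n.factorial : ℂ) ≠ 0 := by exact_mod_cast n.factorial_ne_zero
  have hp : (Real.pi : ℂ) ^ (-(2 * n + 2 : ℂ) / 2) ≠ 0 := by simp [cpow_eq_zero_iff, hpi]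
  rw [← ofReal_log Real.pi_pos.le]
  field_simp
  ring

lemma logDeriv_riemannXi_two_mul_nat_add_two (n : ℕ) :
    logDeriv riemannXi (2 * n + 2) = 1 / (2 * n + 2) + 1 / (2 * n + 1) +
      (-Real.log Real.pi - Real.eulerMascheroniConstant + harmonic n) / 2 -
      LSeries (fun k => (ArithmeticFunction.vonMangoldt k : ℂ)) (2 * n + 2) := by
  have hn : (0 : ℝ) ≤ n := n.cast_nonneg
  have hre : (2 * n + 2 : ℂ).re = 2 * n + 2 := by simp
  have h1 : 1 < (2 * n + 2 : ℂ).re := by rw [hre]; linarith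
  have hne0 : (2 * n + 2 : ℂ) ≠ 0 := fun h => by rw [h] at h1; norm_num at h1
  have hne1 : (2 * n + 2 : ℂ) ≠ 1 := fun h => by rw [h] at h1; norm_num at h1
  have hs1 : (2 * n + 2 : ℂ) - 1 ≠ 0 := sub_ne_zero.2 hne1
  have hev : riemannXi =ᶠ[𝓝 (2 * n + 2 : ℂ)]
      (fun s => s * (s - 1) * Gammaℝ s * riemannZeta s) := by
    have : IsOpen {s : ℂ | 1 < s.re} := isOpen_lt continuous_const continuous_re
    filter_upwards [this.mem_nhds h1] with s hs
    have hs : 1 < s.re := hs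
    exact riemannXi_eq_mul_riemannZeta (by linarith) (fun h => by rw [h] at hs; norm_num at hs)
  obtain ⟨dG, lG⟩ := logDeriv_Gammaℝ_two_mul_nat_add_two n
  have gne : Gammaℝ (2 * n + 2) ≠ 0 := Gammaℝ_ne_zero_of_re_pos (by linarith)
  have zne : riemannZeta (2 * n + 2) ≠ 0 := riemannZeta_ne_zero_of_one_le_re h1.le
  have dz := differentiableAt_riemannZeta hne1
  have dp : DifferentiableAt ℂ (fun s : ℂ => s * (s - 1)) (2 * n + 2) := by fun_prop
  rw [(logDeriv_congr_nhds hev).eq_of_nhds,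
    logDeriv_mul (f := fun s : ℂ => s * (s - 1) * Gammaℝ s) (g := riemannZeta) _
      (mul_ne_zero (mul_ne_zero hne0 hs1) gne) zne (dp.mul dG) dz,
    logDeriv_mul (f := fun s : ℂ => s * (s - 1)) (g := Gammaℝ) _
      (mul_ne_zero hne0 hs1) gne dp dG,
    logDeriv_mul (f := fun s : ℂ => s) (g := fun s : ℂ => s - 1) _ hne0 hs1 (by fun_prop)
      (by fun_prop), lG, logDeriv_apply riemannZeta]
  have hL := ArithmeticFunction.LSeries_vonMangoldt_eq_deriv_riemannZeta_div h1
  rw [hL]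
  have l1 : logDeriv (fun s : ℂ => s - 1) (2 * n + 2) = 1 / (2 * n + 1) := by
    rw [logDeriv_apply]; simp; ring_nf
  rw [l1, logDeriv_id']
  ring

lemma summable_vonMangoldt_div_pow (n : ℕ) :
    Summable fun k : ℕ => ArithmeticFunction.vonMangoldt k / (k : ℝ) ^ (2 * n + 2) := by
  have h1 : 1 < (2 * n + 2 : ℂ).re := by
    have : (0 : ℝ) ≤ n := n.cast_nonneg
    simp; linarith
  have h := (ArithmeticFunction.LSeriesSummable_vonMangoldt h1).norm
  refine h.congr fun k => ?_
  rcases eq_or_ne k 0 with rfl | hk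
  · simp
  rw [LSeries.norm_term_eq]
  simp only [hk, if_false]
  rw [norm_real, Real.norm_of_nonneg ArithmeticFunction.vonMangoldt_nonneg]
  congr 1
  have : (2 * n + 2 : ℂ).re = ((2 * n + 2 : ℕ) : ℝ) := by simp
  rw [this, Real.rpow_natCast]

lemma re_logDeriv_riemannXi_two_mul_nat_add_two (n : ℕ) :
    (logDeriv riemannXi ((2 * n + 2 : ℝ) : ℂ)).re = 1 / (2 * n + 2) + 1 / (2 * n + 1) +
      (-Real.log Real.pi - Real.eulerMascheroniConstant + harmonic n) / 2 -
      ∑' k : ℕ, ArithmeticFunction.vonMangoldt k / (k : ℝ) ^ (2 * n + 2) := by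
  have hL : LSeries (fun k => (ArithmeticFunction.vonMangoldt k : ℂ)) (2 * n + 2) =
      ((∑' k : ℕ, ArithmeticFunction.vonMangoldt k / (k : ℝ) ^ (2 * n + 2) : ℝ) : ℂ) := by
    rw [ofReal_tsum, LSeries]
    refine tsum_congr fun k => ?_
    rcases eq_or_ne k 0 with rfl | hk
    · simp
    rw [LSeries.term_of_ne_zero hk]
    push_cast
    congr 1
    rw [← cpow_natCast]; push_cast; rfl
  have h := logDeriv_riemannXi_two_mul_nat_add_two n
  rw [hL] at h
  have e : ((2 * n + 2 : ℝ) : ℂ) = 2 * n + 2 := by push_cast; rfl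
  rw [e, h, ← ofReal_re (1 / (2 * n + 2) + 1 / (2 * n + 1) +
      (-Real.log Real.pi - Real.eulerMascheroniConstant + harmonic n) / 2 -
      ∑' k : ℕ, ArithmeticFunction.vonMangoldt k / (k : ℝ) ^ (2 * n + 2))]
  push_cast
  rfl

/-- The weighted Chebyshev sum `∑ Λ(k) (x / k - 1)` over `k ≤ x`. -/
noncomputable def chebyshevT (x : ℝ) : ℝ :=
  ∑' k : ℕ, ArithmeticFunction.vonMangoldt k * max (x / k - 1) 0

/-- The contribution of the trivial zeros to the explicit formula for `chebyshevT`. -/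
noncomputable def trivialZerosSum (x : ℝ) : ℝ :=
  ∑' j : ℕ, x⁻¹ ^ (2 * j + 2) / ((2 * j + 2) * (2 * j + 3))

/-- The contribution of the nontrivial zeros to the explicit formula for `chebyshevT`. -/
noncomputable def chebyshevR (x : ℝ) : ℝ :=
  chebyshevT x - (x * Real.log x - (1 + Real.eulerMascheroniConstant) * x +
    Real.log (2 * Real.pi) - trivialZerosSum x)

lemma integral_max_inv_sub_mul_pow (k n : ℕ) :
    ∫ y in (0 : ℝ)..1, max ((k : ℝ)⁻¹ - y) 0 * y ^ (2 * n) =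
      1 / (k : ℝ) ^ (2 * n + 2) / ((2 * n + 2) * (2 * n + 1)) := by
  rcases eq_or_ne k 0 with rfl | hk
  · rw [intervalIntegral.integral_congr (g := fun _ => (0 : ℝ))]
    · simp
    · intro y hy
      rw [uIcc_of_le zero_le_one] at hy
      have : max (-y) 0 = 0 := max_eq_right (by linarith [hy.1])
      simp [this]
  have hk1 : (1 : ℝ) ≤ k := by exact_mod_cast Nat.one_le_iff_ne_zero.2 hk
  have hk0 : (0 : ℝ) < k := by linarith
  have hi0 : (0 : ℝ) ≤ (k : ℝ)⁻¹ := by positivity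
  have hi1 : (k : ℝ)⁻¹ ≤ 1 := inv_le_one_of_one_le₀ hk1
  have hc : Continuous fun y : ℝ => max ((k : ℝ)⁻¹ - y) 0 * y ^ (2 * n) := by fun_prop
  rw [← intervalIntegral.integral_add_adjacent_intervals (hc.intervalIntegrable 0 (k : ℝ)⁻¹)
    (hc.intervalIntegrable _ 1)]
  rw [intervalIntegral.integral_congr (a := 0) (g := fun y => (k : ℝ)⁻¹ * y ^ (2 * n) - y ^ (2 * n + 1)),
    intervalIntegral.integral_congr (b := 1) (g := fun _ => (0 : ℝ))]
  · rw [intervalIntegral.integral_sub (by apply Continuous.intervalIntegrable; fun_prop)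
      (by apply Continuous.intervalIntegrable; fun_prop), intervalIntegral.integral_const_mul,
      integral_pow, integral_pow]
    simp only [intervalIntegral.integral_zero]
    simp only [ne_eq, Nat.add_eq_zero_iff, one_ne_zero, and_false, not_false_eq_true, zero_pow, inv_pow,
      sub_zero]
    push_cast
    field_simp
    ring
  · intro y hy
    rw [uIcc_of_le hi1] at hy
    simp [max_eq_right (sub_nonpos.2 hy.1)]
  · intro y hy
    rw [uIcc_of_le hi0] at hy
    simp only [max_eq_left (sub_nonneg.2 hy.2)]
    ring

lemma chebyshevT_inv_mul_pow {y : ℝ} (hy : 0 < y) (n : ℕ) :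
    chebyshevT y⁻¹ * y ^ (2 * n + 1) =
      ∑' k : ℕ, ArithmeticFunction.vonMangoldt k * (max ((k : ℝ)⁻¹ - y) 0 * y ^ (2 * n)) := by
  rw [chebyshevT, ← tsum_mul_right]
  refine tsum_congr fun k => ?_
  have : max ((k : ℝ)⁻¹ - y) 0 = max (y⁻¹ / k - 1) 0 * y := by
    rw [max_mul_of_nonneg _ _ hy.le, zero_mul]
    congr 1
    field_simp
  rw [this]; ring

lemma integral_chebyshevT (n : ℕ) :
    IntervalIntegrable (fun y => chebyshevT y⁻¹ * y ^ (2 * n + 1)) volume 0 1 ∧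
    ∫ y in (0 : ℝ)..1, chebyshevT y⁻¹ * y ^ (2 * n + 1) =
      (∑' k : ℕ, ArithmeticFunction.vonMangoldt k / (k : ℝ) ^ (2 * n + 2)) /
        ((2 * n + 2) * (2 * n + 1)) := by
  set F : ℕ → ℝ → ℝ := fun k y =>
    ArithmeticFunction.vonMangoldt k * (max ((k : ℝ)⁻¹ - y) 0 * y ^ (2 * n)) with hF
  have hF0 (k : ℕ) (y : ℝ) : 0 ≤ F k y := by
    have := ArithmeticFunction.vonMangoldt_nonneg (n := k)
    have h2 : 0 ≤ y ^ (2 * n) := by rw [pow_mul]; positivity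
    simp only [hF]; positivity
  have hFi (k : ℕ) : ∫ y in Ioc (0 : ℝ) 1, F k y =
      ArithmeticFunction.vonMangoldt k / (k : ℝ) ^ (2 * n + 2) / ((2 * n + 2) * (2 * n + 1)) := by
    rw [← intervalIntegral.integral_of_le zero_le_one]
    simp only [hF]
    rw [intervalIntegral.integral_const_mul, integral_max_inv_sub_mul_pow]; ring
  have hint (k : ℕ) : IntegrableOn (F k) (Ioc 0 1) := by
    rw [← intervalIntegrable_iff_integrableOn_Ioc_of_le zero_le_one]
    apply Continuous.intervalIntegrable
    simp only [hF]; fun_prop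
  have hs := (summable_vonMangoldt_div_pow n).div_const ((2 * n + 2 : ℝ) * (2 * n + 1))
  have hsn : Summable fun k => ∫ y in Ioc (0 : ℝ) 1, ‖F k y‖ := by
    simp only [fun k y => Real.norm_of_nonneg (hF0 k y), hFi]
    exact hs
  have H := hasSum_integral_of_summable_integral_norm hint hsn
  have hval : ∫ y in Ioc (0 : ℝ) 1, ∑' k, F k y =
      (∑' k : ℕ, ArithmeticFunction.vonMangoldt k / (k : ℝ) ^ (2 * n + 2)) /
        ((2 * n + 2) * (2 * n + 1)) := by
    rw [← H.tsum_eq]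
    simp only [hFi]
    rw [tsum_div_const]
  have hpos : 0 < ∑' k : ℕ, ArithmeticFunction.vonMangoldt k / (k : ℝ) ^ (2 * n + 2) := by
    refine (summable_vonMangoldt_div_pow n).tsum_pos
      (fun k => div_nonneg ArithmeticFunction.vonMangoldt_nonneg (by positivity)) 2 ?_
    rw [ArithmeticFunction.vonMangoldt_apply_prime Nat.prime_two]
    have := Real.log_pos (by norm_num : (1 : ℝ) < (2 : ℕ))
    positivity
  have I : Integrable (fun y => ∑' k, F k y) (volume.restrict (Ioc 0 1)) := by
    by_contra h
    rw [integral_undef h] at hval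
    have : 0 < (∑' k : ℕ, ArithmeticFunction.vonMangoldt k / (k : ℝ) ^ (2 * n + 2)) /
        ((2 * n + 2) * (2 * n + 1)) := by positivity
    exact this.ne hval
  have hcongr : EqOn (fun y => ∑' k, F k y) (fun y => chebyshevT y⁻¹ * y ^ (2 * n + 1)) (Ioc 0 1) :=
    fun y hy => (chebyshevT_inv_mul_pow hy.1 n).symm
  constructor
  · rw [intervalIntegrable_iff_integrableOn_Ioc_of_le zero_le_one]
    exact IntegrableOn.congr_fun I hcongr measurableSet_Ioc
  · rw [intervalIntegral.integral_of_le zero_le_one,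
      ← setIntegral_congr_fun measurableSet_Ioc hcongr, hval]

lemma hasSum_sub_succ_of_tendsto {f : ℕ → ℝ} (hf : Antitone f) (h : Tendsto f atTop (𝓝 0)) :
    HasSum (fun j => f j - f (j + 1)) (f 0) := by
  rw [hasSum_iff_tendsto_nat_of_nonneg fun j => sub_nonneg.2 (hf j.le_succ)]
  simp only [Finset.sum_range_sub']
  simpa using tendsto_const_nhds.sub h

lemma hasSum_inv_sub_inv_add (m : ℕ) :
    HasSum (fun j : ℕ => 1 / ((j : ℝ) + 1) - 1 / (j + 1 + m)) (harmonic m : ℝ) := by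
  have h (i : ℕ) : HasSum (fun j : ℕ => 1 / ((j : ℝ) + 1 + i) - 1 / (((j + 1 : ℕ) : ℝ) + 1 + i))
      (1 / (((0 : ℕ) : ℝ) + 1 + i)) := by
    refine hasSum_sub_succ_of_tendsto (f := fun j : ℕ => 1 / ((j : ℝ) + 1 + i)) ?_ ?_
    · intro a b hab
      have : (a : ℝ) ≤ b := by exact_mod_cast hab
      simp only
      gcongr
    · refine tendsto_const_nhds.div_atTop ?_
      exact tendsto_atTop_add_const_right _ _
        (tendsto_atTop_add_const_right _ _ tendsto_natCast_atTop_atTop)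
  have H := hasSum_sum (s := Finset.range m) fun i _ => h i
  convert H using 1
  · ext j
    have := Finset.sum_range_sub' (fun i : ℕ => 1 / ((j : ℝ) + 1 + i)) m
    simp only [Nat.cast_zero, add_zero] at this
    rw [← this]
    refine Finset.sum_congr rfl fun i _ => ?_
    push_cast
    ring_nf
  · simp [harmonic, add_comm]

lemma hasSum_inv_even_sub_inv_odd :
    HasSum (fun j : ℕ => 1 / ((2 : ℝ) * j + 2) - 1 / (2 * j + 3)) (1 - Real.log 2) := by
  rw [hasSum_iff_tendsto_nat_of_nonneg]
  swap
  · intro j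
    rw [sub_nonneg]
    gcongr; norm_num
  have hsum (N : ℕ) : ∑ j ∈ Finset.range N, (1 / ((2 : ℝ) * j + 2) - 1 / (2 * j + 3)) =
      (harmonic N : ℝ) - harmonic (2 * N + 1) + 1 := by
    induction N with
    | zero => simp [harmonic]
    | succ N ih =>
      rw [Finset.sum_range_succ, ih, show 2 * (N + 1) + 1 = 2 * N + 1 + 1 + 1 by ring,
        harmonic_succ N, harmonic_succ (2 * N + 1 + 1), harmonic_succ (2 * N + 1)]
      push_cast
      field_simp
      ring
  simp only [hsum]
  have h1 := Real.tendsto_harmonic_sub_log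
  have h2 : Tendsto (fun N : ℕ => 2 * N + 1) atTop atTop :=
    tendsto_atTop_mono (fun N => by simp only [id]; omega) tendsto_id
  have h3 := h1.comp h2
  have h4 : Tendsto (fun N : ℕ => Real.log (2 + 1 / (N : ℝ))) atTop (𝓝 (Real.log 2)) := by
    have : Tendsto (fun N : ℕ => (2 : ℝ) + 1 / (N : ℝ)) atTop (𝓝 (2 + 0)) :=
      tendsto_const_nhds.add tendsto_one_div_atTop_nhds_zero_nat
    rw [add_zero] at this
    exact (Real.continuousAt_log (by norm_num)).tendsto.comp this
  have h5 := ((h1.sub h3).sub h4).add_const 1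
  rw [show Real.eulerMascheroniConstant - Real.eulerMascheroniConstant - Real.log 2 + 1 =
    1 - Real.log 2 by ring] at h5
  refine h5.congr' ?_
  filter_upwards [eventually_gt_atTop 0] with N hN
  have hN' : (0 : ℝ) < N := by exact_mod_cast hN
  have : (2 + 1 / (N : ℝ)) = (2 * N + 1) / N := by field_simp
  rw [this, Real.log_div (by positivity) hN'.ne']
  simp only [Function.comp]
  push_cast
  ring

lemma integral_pow_mul_log (n : ℕ) :
    IntervalIntegrable (fun y : ℝ => y ^ n * Real.log y) volume 0 1 ∧
    ∫ y in (0 : ℝ)..1, y ^ n * Real.log y = -1 / (n + 1) ^ 2 := by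
  have hi : IntervalIntegrable (fun y : ℝ => y ^ n * Real.log y) volume 0 1 := by
    refine IntervalIntegrable.continuousOn_mul ?_ (by fun_prop)
    exact intervalIntegral.intervalIntegrable_log'
  refine ⟨hi, ?_⟩
  have h := intervalIntegral.integral_eq_sub_of_hasDerivAt_of_le
    (f := fun y : ℝ => y ^ n * (y * Real.log y) / (n + 1) - y ^ (n + 1) / (n + 1) ^ 2)
    (f' := fun y : ℝ => y ^ n * Real.log y) zero_le_one ?_ ?_ hi
  · rw [h]; simp; ring
  · have := Real.continuous_mul_log
    fun_prop
  · intro y hy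
    have hy0 : y ≠ 0 := hy.1.ne'
    have h1 := ((hasDerivAt_pow (n + 1) y).mul (Real.hasDerivAt_log hy0)).div_const ((n : ℝ) + 1)
    have h2 := (hasDerivAt_pow (n + 1) y).div_const (((n : ℝ) + 1) ^ 2)
    have h3 := h1.sub h2
    have e : (fun y : ℝ => y ^ n * (y * Real.log y) / (n + 1) - y ^ (n + 1) / (n + 1) ^ 2) =
        (fun y : ℝ => y ^ (n + 1) * Real.log y / (n + 1) - y ^ (n + 1) / (n + 1) ^ 2) := by
      ext z; ring
    rw [e]
    refine HasDerivAt.congr_deriv h3 ?_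
    have : (n : ℝ) + 1 ≠ 0 := by positivity
    push_cast
    field_simp
    ring

lemma summable_inv_even_mul_odd :
    Summable fun j : ℕ => 1 / (((2 : ℝ) * j + 2) * (2 * j + 3)) := by
  refine hasSum_inv_even_sub_inv_odd.summable.congr fun j => ?_
  field_simp
  ring

lemma continuousOn_trivialZerosSum_inv :
    ContinuousOn (fun y : ℝ => trivialZerosSum y⁻¹) (Icc 0 1) := by
  unfold trivialZerosSum
  refine continuousOn_tsum (fun j => by simp only [inv_inv]; fun_prop) summable_inv_even_mul_odd ?_
  intro j y hy
  rw [inv_inv, Real.norm_of_nonneg (by have := hy.1; positivity)]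
  gcongr
  exact pow_le_one₀ hy.1 hy.2

lemma integral_trivialZerosSum (n : ℕ) :
    ∫ y in (0 : ℝ)..1, trivialZerosSum y⁻¹ * y ^ (2 * n + 1) =
      (1 - Real.log 2) / (2 * n + 1) -
        (harmonic (n + 1) : ℝ) / 2 / ((2 * n + 2) * (2 * n + 1)) := by
  set F : ℕ → ℝ → ℝ := fun j y => y ^ (2 * j + 2 + (2 * n + 1)) / ((2 * j + 2) * (2 * j + 3)) with hF
  have hFi (j : ℕ) : ∫ y in Ioc (0 : ℝ) 1, F j y =
      1 / (2 * n + 1) * (1 / ((2 : ℝ) * j + 2) - 1 / (2 * j + 3)) -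
      1 / 2 / ((2 * n + 2) * (2 * n + 1)) * (1 / ((j : ℝ) + 1) - 1 / (j + 1 + (n + 1 : ℕ))) := by
    rw [← intervalIntegral.integral_of_le zero_le_one]
    simp only [hF]
    rw [intervalIntegral.integral_div, integral_pow]
    simp only [one_pow, ne_eq, Nat.add_eq_zero_iff, one_ne_zero, and_false, not_false_eq_true,
      zero_pow, sub_zero]
    push_cast
    have h1 : (j : ℝ) + 1 + (n + 1) ≠ 0 := by positivity
    have h2 : (2 : ℝ) * j + 2 + (2 * n + 1) + 1 ≠ 0 := by positivity
    field_simp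
    ring
  have hint (j : ℕ) : IntegrableOn (F j) (Ioc 0 1) := by
    rw [← intervalIntegrable_iff_integrableOn_Ioc_of_le zero_le_one]
    apply Continuous.intervalIntegrable
    simp only [hF]; fun_prop
  have hS := (hasSum_inv_even_sub_inv_odd.mul_left (1 / (2 * n + 1 : ℝ))).sub
    ((hasSum_inv_sub_inv_add (n + 1)).mul_left (1 / 2 / ((2 * n + 2 : ℝ) * (2 * n + 1))))
  have hsn : Summable fun j => ∫ y in Ioc (0 : ℝ) 1, ‖F j y‖ := by
    have (j : ℕ) : ∫ y in Ioc (0 : ℝ) 1, ‖F j y‖ = ∫ y in Ioc (0 : ℝ) 1, F j y := by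
      refine setIntegral_congr_fun measurableSet_Ioc fun y hy => ?_
      refine Real.norm_of_nonneg ?_
      have := hy.1
      simp only [hF]; positivity
    simp only [this, hFi]
    exact hS.summable
  have H := hasSum_integral_of_summable_integral_norm hint hsn
  simp only [hFi] at H
  have e := H.unique hS
  rw [intervalIntegral.integral_of_le zero_le_one]
  have hcongr : EqOn (fun y => trivialZerosSum y⁻¹ * y ^ (2 * n + 1)) (fun y => ∑' k, F k y)
      (Ioc 0 1) := by
    intro y hy
    simp only [trivialZerosSum, inv_inv, hF]
    rw [← tsum_mul_right]
    refine tsum_congr fun j => ?_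
    rw [pow_add y (2 * j + 2)]; ring
  rw [setIntegral_congr_fun measurableSet_Ioc hcongr, e]
  ring

lemma integral_chebyshevR (n : ℕ) :
    IntervalIntegrable (fun y => chebyshevR y⁻¹ * y ^ (2 * n + 1)) volume 0 1 ∧
    ∫ y in (0 : ℝ)..1, chebyshevR y⁻¹ * y ^ (2 * n + 1) =
      ((logDeriv riemannXi ((2 * n + 2 : ℝ) : ℂ)).re -
        (2 * (2 * n + 2 : ℝ) - 1) * (logDeriv riemannXi 1).re) /
          ((2 * n + 2 : ℝ) * (1 - (2 * n + 2 : ℝ))) := by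
  obtain ⟨hT, iT⟩ := integral_chebyshevT n
  obtain ⟨hl, il⟩ := integral_pow_mul_log (2 * n)
  have hp (k : ℕ) (c : ℝ) : IntervalIntegrable (fun y : ℝ => c * y ^ k) volume 0 1 :=
    Continuous.intervalIntegrable (by fun_prop) _ _
  have hB : IntervalIntegrable (fun y : ℝ => trivialZerosSum y⁻¹ * y ^ (2 * n + 1)) volume 0 1 := by
    apply ContinuousOn.intervalIntegrable
    rw [uIcc_of_le zero_le_one]
    exact continuousOn_trivialZerosSum_inv.mul (by fun_prop)
  have hsum := (((hT.add hl).add (hp (2 * n) (1 + Real.eulerMascheroniConstant))).sub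
    (hp (2 * n + 1) (Real.log (2 * Real.pi)))).add hB
  have hcongr : EqOn (fun y => chebyshevR y⁻¹ * y ^ (2 * n + 1)) (fun y =>
      chebyshevT y⁻¹ * y ^ (2 * n + 1) + y ^ (2 * n) * Real.log y +
        (1 + Real.eulerMascheroniConstant) * y ^ (2 * n) -
        Real.log (2 * Real.pi) * y ^ (2 * n + 1) + trivialZerosSum y⁻¹ * y ^ (2 * n + 1))
      (Ioc 0 1) := by
    intro y hy
    have : y ≠ 0 := hy.1.ne'
    simp only [chebyshevR, Real.log_inv]
    field_simp
    ring
  constructor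
  · rw [intervalIntegrable_iff_integrableOn_Ioc_of_le zero_le_one] at hsum ⊢
    exact IntegrableOn.congr_fun hsum hcongr.symm measurableSet_Ioc
  · rw [intervalIntegral.integral_of_le zero_le_one, setIntegral_congr_fun measurableSet_Ioc hcongr,
      ← intervalIntegral.integral_of_le zero_le_one,
      intervalIntegral.integral_add (((hT.add hl).add (hp _ _)).sub (hp _ _)) hB,
      intervalIntegral.integral_sub ((hT.add hl).add (hp _ _)) (hp _ _),
      intervalIntegral.integral_add (hT.add hl) (hp _ _),
      intervalIntegral.integral_add hT hl, iT, il, integral_trivialZerosSum,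
      intervalIntegral.integral_const_mul, intervalIntegral.integral_const_mul, integral_pow,
      integral_pow, re_logDeriv_riemannXi_two_mul_nat_add_two, logDeriv_riemannXi_one]
    have hre : (((Real.eulerMascheroniConstant - Real.log (4 * Real.pi)) / 2 + 1 : ℂ)).re =
        (Real.eulerMascheroniConstant - Real.log (4 * Real.pi)) / 2 + 1 := by
      rw [← ofReal_re ((Real.eulerMascheroniConstant - Real.log (4 * Real.pi)) / 2 + 1)]
      push_cast; rfl
    rw [hre, harmonic_succ, Real.log_mul (by norm_num) Real.pi_ne_zero,
      Real.log_mul (by norm_num) Real.pi_ne_zero, show (4 : ℝ) = 2 ^ 2 by norm_num, Real.log_pow]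
    have h1 : (1 : ℝ) - (2 * n + 2) ≠ 0 := by
      have : (0 : ℝ) ≤ n := n.cast_nonneg
      intro h; linarith
    have h1' : (1 : ℝ) - (2 * n + 2) = -(2 * n + 1) := by ring
    rw [h1']
    simp only [one_pow, ne_eq, Nat.add_eq_zero_iff, one_ne_zero, and_false, not_false_eq_true,
      zero_pow, sub_zero]
    push_cast
    generalize ∑' k : ℕ, ArithmeticFunction.vonMangoldt k / (k : ℝ) ^ (2 * n + 2) = S
    generalize Real.eulerMascheroniConstant = γ
    generalize (harmonic n : ℝ) = H
    generalize Real.log 2 = l2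
    generalize Real.log Real.pi = lp
    have h2 : (2 * (n : ℝ) + 1 + 1) = 2 * (n + 1) := by ring
    have h3 : (2 * (n : ℝ) + 2) = 2 * (n + 1) := by ring
    rw [h2, h3]
    have h4 : (n : ℝ) + 1 ≠ 0 := by positivity
    have h5 : 2 * (n : ℝ) + 1 ≠ 0 := by positivity
    field_simp
    ring

lemma abs_integral_eval_mul_chebyshevR_le (hRH : RiemannHypothesis) (p : Polynomial ℝ) :
    |∫ y in (0 : ℝ)..1, p.eval (y ^ 2) * (chebyshevR y⁻¹ * y)| ≤
      2 * (logDeriv riemannXi 1).re * ∫ y in (0 : ℝ)..1, |p.eval (y ^ 2)| * y ^ (1 / 2 : ℝ) := by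
  have hs : ∀ i ∈ Finset.range (p.natDegree + 1), (1 : ℝ) < 2 * (i : ℝ) + 2 := fun i _ => by
    have : (0 : ℝ) ≤ i := i.cast_nonneg
    linarith
  have h := abs_sum_logDeriv_riemannXi_le hRH (Finset.range (p.natDegree + 1)) p.coeff
    (fun i => 2 * (i : ℝ) + 2) hs
  have e1 : ∫ y in (0 : ℝ)..1, p.eval (y ^ 2) * (chebyshevR y⁻¹ * y) =
      ∑ i ∈ Finset.range (p.natDegree + 1), p.coeff i *
        (((logDeriv riemannXi ((2 * i + 2 : ℝ) : ℂ)).re -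
          (2 * (2 * i + 2 : ℝ) - 1) * (logDeriv riemannXi 1).re) /
            ((2 * i + 2 : ℝ) * (1 - (2 * i + 2 : ℝ)))) := by
    simp only [← fun i => (integral_chebyshevR i).2, ← intervalIntegral.integral_const_mul]
    rw [← intervalIntegral.integral_finsetSum fun i _ => (integral_chebyshevR i).1.const_mul _]
    refine intervalIntegral.integral_congr fun y _ => ?_
    simp only [Polynomial.eval_eq_sum_range, Finset.sum_mul]
    refine Finset.sum_congr rfl fun i _ => ?_
    rw [← pow_mul, pow_succ]; ring
  have e2 : ∫ y in (0 : ℝ)..1, |p.eval (y ^ 2)| * y ^ (1 / 2 : ℝ) =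
      ∫ y in (0 : ℝ)..1, |∑ i ∈ Finset.range (p.natDegree + 1),
        p.coeff i * y ^ ((2 * (i : ℝ) + 2) - 1)| * y ^ (-(1 / 2) : ℝ) := by
    rw [intervalIntegral.integral_of_le zero_le_one, intervalIntegral.integral_of_le zero_le_one]
    refine setIntegral_congr_fun measurableSet_Ioc fun y hy => ?_
    have hy0 := hy.1
    have : ∑ i ∈ Finset.range (p.natDegree + 1), p.coeff i * y ^ ((2 * (i : ℝ) + 2) - 1) =
        p.eval (y ^ 2) * y := by
      rw [Polynomial.eval_eq_sum_range, Finset.sum_mul]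
      refine Finset.sum_congr rfl fun i _ => ?_
      rw [show (2 * (i : ℝ) + 2) - 1 = ((2 * i + 1 : ℕ) : ℝ) by push_cast; ring,
        Real.rpow_natCast, ← pow_mul, pow_succ, mul_assoc]
    simp only [this, abs_mul, abs_of_pos hy0]
    rw [mul_assoc]
    congr 1
    conv_rhs => rw [← Real.rpow_one y, ← Real.rpow_mul hy0.le, ← Real.rpow_add hy0]
    norm_num
  rw [e1, e2]
  linarith

lemma abs_integral_mul_le_of_forall_polynomial {f w : ℝ → ℝ}
    (hf : IntervalIntegrable f volume 0 1) (hw : Continuous w) (hw0 : ∀ y, 0 ≤ w y)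
    (h : ∀ p : Polynomial ℝ, |∫ y in (0 : ℝ)..1, p.eval (y ^ 2) * f y| ≤
      ∫ y in (0 : ℝ)..1, |p.eval (y ^ 2)| * w y) {φ : ℝ → ℝ} (hφ : Continuous φ) :
    |∫ y in (0 : ℝ)..1, φ y * f y| ≤ ∫ y in (0 : ℝ)..1, |φ y| * w y := by
  set A := (∫ y in (0 : ℝ)..1, w y) + ∫ y in (0 : ℝ)..1, |f y| with hA
  have key : ∀ ε : ℝ, 0 < ε →
      |∫ y in (0 : ℝ)..1, φ y * f y| ≤ (∫ y in (0 : ℝ)..1, |φ y| * w y) + ε * A := by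
    intro ε hε
    obtain ⟨p, hp⟩ := exists_polynomial_near_of_continuousOn 0 1 (fun u => φ (√u))
      (by fun_prop) ε hε
    have hp' : ∀ y ∈ Icc (0 : ℝ) 1, |p.eval (y ^ 2) - φ y| ≤ ε := fun y hy => by
      have := hp (y ^ 2) ⟨by positivity, pow_le_one₀ hy.1 hy.2⟩
      rw [Real.sqrt_sq hy.1] at this
      exact this.le
    have i1 : IntervalIntegrable (fun y => φ y * f y) volume 0 1 :=
      hf.continuousOn_mul hφ.continuousOn
    have i2 : IntervalIntegrable (fun y => p.eval (y ^ 2) * f y) volume 0 1 :=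
      hf.continuousOn_mul (by fun_prop)
    have i3 : IntervalIntegrable (fun y => ε * |f y|) volume 0 1 := hf.abs.const_mul _
    have d1 : |∫ y in (0 : ℝ)..1, (φ y * f y - p.eval (y ^ 2) * f y)| ≤
        ε * ∫ y in (0 : ℝ)..1, |f y| := by
      rw [← intervalIntegral.integral_const_mul]
      refine (intervalIntegral.abs_integral_le_integral_abs zero_le_one).trans ?_
      refine intervalIntegral.integral_mono_on zero_le_one (i1.sub i2).abs i3 fun y hy => ?_
      rw [← sub_mul, abs_mul, abs_sub_comm]
      exact mul_le_mul_of_nonneg_right (hp' y hy) (abs_nonneg _)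
    have d2 : ∫ y in (0 : ℝ)..1, |p.eval (y ^ 2)| * w y ≤
        (∫ y in (0 : ℝ)..1, |φ y| * w y) + ε * ∫ y in (0 : ℝ)..1, w y := by
      rw [← intervalIntegral.integral_const_mul, ← intervalIntegral.integral_add
        (by apply Continuous.intervalIntegrable; fun_prop)
        (by apply Continuous.intervalIntegrable; fun_prop)]
      refine intervalIntegral.integral_mono_on zero_le_one
        (by apply Continuous.intervalIntegrable; fun_prop)
        (by apply Continuous.intervalIntegrable; fun_prop) fun y hy => ?_
      rw [← add_mul]
      refine mul_le_mul_of_nonneg_right ?_ (hw0 y)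
      have := abs_sub_abs_le_abs_sub (p.eval (y ^ 2)) (φ y)
      linarith [hp' y hy]
    rw [intervalIntegral.integral_sub i1 i2] at d1
    have := abs_sub_abs_le_abs_sub (∫ y in (0 : ℝ)..1, φ y * f y)
      (∫ y in (0 : ℝ)..1, p.eval (y ^ 2) * f y)
    have := h p
    rw [hA, mul_add]
    linarith
  refine le_of_forall_pos_le_add fun δ hδ => ?_
  have hA0 : 0 ≤ A := add_nonneg (intervalIntegral.integral_nonneg zero_le_one fun y _ => hw0 y)
    (intervalIntegral.integral_nonneg zero_le_one fun y _ => abs_nonneg _)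
  refine (key (δ / (A + 1)) (by positivity)).trans ?_
  have : δ / (A + 1) * A ≤ δ := by
    rw [div_mul_eq_mul_div, div_le_iff₀ (by linarith)]
    nlinarith
  linarith

lemma mul_le_of_forall_polynomial {f w : ℝ → ℝ}
    (hf : IntervalIntegrable f volume 0 1) (hw : Continuous w) (hw0 : ∀ y, 0 ≤ w y)
    (h : ∀ p : Polynomial ℝ, |∫ y in (0 : ℝ)..1, p.eval (y ^ 2) * f y| ≤
      ∫ y in (0 : ℝ)..1, |p.eval (y ^ 2)| * w y) {y₀ : ℝ} (hy₀ : y₀ ∈ Icc (0 : ℝ) 1)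
    (hc : ContinuousAt f y₀) {σ : ℝ} (hσ : |σ| = 1) : σ * f y₀ ≤ w y₀ := by
  by_contra! hlt
  set c := (σ * f y₀ - w y₀) / 2 with hcdef
  have hc0 : 0 < c := by rw [hcdef]; linarith
  have hev : ∀ᶠ y in 𝓝 y₀, c < σ * f y - w y :=
    ((hc.const_mul σ).sub hw.continuousAt).eventually_const_lt
      (show c < σ * f y₀ - w y₀ by rw [hcdef]; linarith)
  obtain ⟨δ, hδ, hball⟩ := Metric.eventually_nhds_iff.1 hev
  set φ : ℝ → ℝ := fun y => max (δ - |y - y₀|) 0 with hφdef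
  have hφ : Continuous φ := by simp only [hφdef]; fun_prop
  have hφ0 (y : ℝ) : 0 ≤ φ y := le_max_right _ _
  have h1 := abs_integral_mul_le_of_forall_polynomial hf hw hw0 h hφ
  have i1 : IntervalIntegrable (fun y => σ * (φ y * f y)) volume 0 1 :=
    (hf.continuousOn_mul hφ.continuousOn).const_mul σ
  have i2 : IntervalIntegrable (fun y => φ y * w y + c * φ y) volume 0 1 := by
    apply Continuous.intervalIntegrable; fun_prop
  have h2 : ∫ y in (0 : ℝ)..1, (φ y * w y + c * φ y) ≤ ∫ y in (0 : ℝ)..1, σ * (φ y * f y) := by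
    refine intervalIntegral.integral_mono_on zero_le_one i2 i1 fun y _ => ?_
    by_cases hy : dist y y₀ < δ
    · nlinarith [hball hy, hφ0 y]
    · have : φ y = 0 := max_eq_right (by rw [Real.dist_eq] at hy; linarith)
      simp [this]
  have h3 : 0 < ∫ y in (0 : ℝ)..1, φ y :=
    intervalIntegral.integral_pos zero_lt_one hφ.continuousOn (fun y _ => hφ0 y)
      ⟨y₀, hy₀, by simp [hφdef, hδ]⟩
  rw [intervalIntegral.integral_add (by apply Continuous.intervalIntegrable; fun_prop)
    (by apply Continuous.intervalIntegrable; fun_prop), intervalIntegral.integral_const_mul,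
    intervalIntegral.integral_const_mul] at h2
  simp only [fun y => abs_of_nonneg (hφ0 y)] at h1
  have h4 : σ * ∫ y in (0 : ℝ)..1, φ y * f y ≤ |∫ y in (0 : ℝ)..1, φ y * f y| := by
    refine (le_abs_self _).trans ?_
    rw [abs_mul, hσ, one_mul]
  nlinarith

lemma chebyshevT_eq_sum {x : ℝ} {N : ℕ} (h : x ≤ N) :
    chebyshevT x =
      ∑ k ∈ Finset.range N, ArithmeticFunction.vonMangoldt k * max (x / k - 1) 0 := by
  refine tsum_eq_sum fun k hk => ?_
  rcases eq_or_ne k 0 with rfl | hk0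
  · simp
  have hk' : x ≤ k := h.trans (by exact_mod_cast not_lt.1 fun h => hk (Finset.mem_range.2 h))
  have hkp : (0 : ℝ) < k := by exact_mod_cast Nat.pos_of_ne_zero hk0
  rw [max_eq_right, mul_zero]
  rw [sub_nonpos, div_le_one hkp]
  exact hk'

lemma continuous_chebyshevT : Continuous chebyshevT := by
  refine continuous_iff_continuousAt.2 fun x => ?_
  obtain ⟨N, hN⟩ := exists_nat_gt x
  have : chebyshevT =ᶠ[𝓝 x] fun x =>
      ∑ k ∈ Finset.range N, ArithmeticFunction.vonMangoldt k * max (x / k - 1) 0 := by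
    filter_upwards [eventually_lt_nhds hN] with z hz
    exact chebyshevT_eq_sum hz.le
  refine ContinuousAt.congr ?_ this.symm
  fun_prop

lemma abs_chebyshevR_le (hRH : RiemannHypothesis) {x : ℝ} (hx : 1 < x) :
    |chebyshevR x| ≤ 2 * (logDeriv riemannXi 1).re * √x := by
  set l := 2 * (logDeriv riemannXi 1).re with hl
  have hl0 : 0 ≤ l := by
    have := re_logDeriv_riemannXi_nonneg hRH (s := 1) (by norm_num)
    positivity
  have hx0 : 0 < x := by linarith
  have hi := (integral_chebyshevR 0).1
  simp only [mul_zero, zero_add, pow_one] at hi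
  have hpoly : ∀ p : Polynomial ℝ,
      |∫ y in (0 : ℝ)..1, p.eval (y ^ 2) * (chebyshevR y⁻¹ * y)| ≤
        ∫ y in (0 : ℝ)..1, |p.eval (y ^ 2)| * (l * √y) := fun p => by
    refine (abs_integral_eval_mul_chebyshevR_le hRH p).trans_eq ?_
    rw [← intervalIntegral.integral_const_mul]
    refine intervalIntegral.integral_congr fun y _ => ?_
    simp only [Real.sqrt_eq_rpow]
    ring
  have hx1 : x⁻¹ ∈ Ioo (0 : ℝ) 1 := ⟨by positivity, inv_lt_one_of_one_lt₀ hx⟩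
  have hc : ContinuousAt (fun y => chebyshevR y⁻¹ * y) x⁻¹ := by
    unfold chebyshevR
    have h1 : ContinuousAt (fun y : ℝ => trivialZerosSum y⁻¹) x⁻¹ :=
      continuousOn_trivialZerosSum_inv.continuousAt (Icc_mem_nhds hx1.1 hx1.2)
    have h2 : ContinuousAt (fun y : ℝ => y⁻¹) x⁻¹ := continuousAt_inv₀ hx1.1.ne'
    have h3 : ContinuousAt (fun y : ℝ => chebyshevT y⁻¹) x⁻¹ :=
      continuous_chebyshevT.continuousAt.comp h2
    have h4 : ContinuousAt (fun y : ℝ => Real.log y⁻¹) x⁻¹ := h2.log (by simpa using hx0.ne')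
    fun_prop
  have hb (σ : ℝ) (hσ : |σ| = 1) := mul_le_of_forall_polynomial hi (by fun_prop)
    (fun y => by positivity) hpoly ⟨hx1.1.le, hx1.2.le⟩ hc hσ
  have h1 := hb 1 (by simp)
  have h2 := hb (-1) (by simp)
  simp only [inv_inv] at h1 h2
  have e : √x⁻¹ = √x * x⁻¹ := by
    rw [Real.sqrt_inv]
    have := Real.sq_sqrt hx0.le
    have : √x ≠ 0 := (Real.sqrt_pos.2 hx0).ne'
    field_simp
    linarith
  rw [e] at h1 h2
  rw [abs_le]
  have hi0 := hx1.1
  constructor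
  · refine le_of_mul_le_mul_right (a := x⁻¹) ?_ hi0
    linarith
  · refine le_of_mul_le_mul_right (a := x⁻¹) ?_ hi0
    linarith

lemma trivialZerosSum_nonneg {x : ℝ} (hx : 0 ≤ x) : 0 ≤ trivialZerosSum x :=
  tsum_nonneg fun j => by positivity

lemma trivialZerosSum_le {x : ℝ} (hx : 2 ≤ x) : trivialZerosSum x ≤ 1 / 18 := by
  have hg := (hasSum_geometric_of_lt_one (r := (1 / 4 : ℝ)) (by norm_num) (by norm_num)).mul_left
    (1 / 24)
  have hx0 : 0 < x := by linarith
  have hle (j : ℕ) : x⁻¹ ^ (2 * j + 2) / ((2 * j + 2) * (2 * j + 3)) ≤ 1 / 24 * (1 / 4) ^ j := by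
    have h1 : x⁻¹ ^ (2 * j + 2) ≤ (1 / 2 : ℝ) ^ (2 * j + 2) := by
      rw [one_div]; gcongr
    have h2 : (1 / 2 : ℝ) ^ (2 * j + 2) = (1 / 4) ^ j / 4 := by
      rw [pow_add, pow_mul]; norm_num; ring
    have h3 : (6 : ℝ) ≤ (2 * j + 2) * (2 * j + 3) := by
      have : (0 : ℝ) ≤ j := j.cast_nonneg
      nlinarith
    calc x⁻¹ ^ (2 * j + 2) / ((2 * j + 2) * (2 * j + 3)) ≤ ((1 / 4) ^ j / 4) / 6 := by
          rw [← h2]; gcongr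
      _ = 1 / 24 * (1 / 4) ^ j := by ring
  have hs := Summable.of_nonneg_of_le (fun j => by positivity) hle hg.summable
  refine (hs.tsum_le_tsum hle hg.summable).trans_eq ?_
  rw [hg.tsum_eq]; norm_num

lemma two_mul_re_logDeriv_riemannXi_one_le : 2 * (logDeriv riemannXi 1).re ≤ 551 / 10000 := by
  rw [logDeriv_riemannXi_one]
  have hre : (((Real.eulerMascheroniConstant - Real.log (4 * Real.pi)) / 2 + 1 : ℂ)).re =
      (Real.eulerMascheroniConstant - Real.log (4 * Real.pi)) / 2 + 1 := by
    rw [← ofReal_re ((Real.eulerMascheroniConstant - Real.log (4 * Real.pi)) / 2 + 1)]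
    push_cast; rfl
  rw [hre]
  have h1 : Real.eulerMascheroniConstant ≤ (harmonic 64 : ℝ) - 6 * Real.log 2 := by
    have := (Real.eulerMascheroniConstant_lt_eulerMascheroniSeq' 64).le
    rw [Real.eulerMascheroniSeq'] at this
    have e : Real.log (64 : ℕ) = 6 * Real.log 2 := by
      rw [show ((64 : ℕ) : ℝ) = 2 ^ 6 by norm_num, Real.log_pow]; norm_num
    rw [e] at this
    simpa using this
  have h2 : (harmonic 64 : ℝ) ≤ 47439 / 10000 := by
    have : harmonic 64 ≤ 47439 / 10000 := by norm_num [harmonic, Finset.sum_range_succ]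
    have h : ((harmonic 64 : ℚ) : ℝ) ≤ ((47439 / 10000 : ℚ) : ℝ) := Rat.cast_le.2 this
    push_cast at h
    exact h
  have h3 : 33 / 20 * Real.log 2 ≤ Real.log Real.pi := by
    have h4 : Real.log (2 ^ 33) ≤ Real.log (Real.pi ^ 20) := by
      refine Real.log_le_log (by norm_num) ?_
      calc (2 : ℝ) ^ 33 ≤ 3.14 ^ 20 := by norm_num
        _ ≤ Real.pi ^ 20 := by gcongr; exact Real.pi_gt_d2.le
    rw [Real.log_pow, Real.log_pow] at h4
    push_cast at h4
    linarith
  have h5 : Real.log (4 * Real.pi) = 2 * Real.log 2 + Real.log Real.pi := by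
    rw [Real.log_mul (by norm_num) Real.pi_ne_zero, show (4 : ℝ) = 2 ^ 2 by norm_num, Real.log_pow]
    norm_num
  have := Real.log_two_gt_d9
  linarith

/-- `√t` times the main error constant plus the main term bounding `chebyshevT`. -/
noncomputable def chebyshevMajorant (l t : ℝ) : ℝ :=
  t * Real.log t - (1 + Real.eulerMascheroniConstant) * t + Real.log (2 * Real.pi) + l * √t

lemma chebyshevT_le (hRH : RiemannHypothesis) {x : ℝ} (hx : 1 < x) :
    chebyshevT x ≤ chebyshevMajorant (2 * (logDeriv riemannXi 1).re) x := by
  have h := (abs_le.1 (abs_chebyshevR_le hRH hx)).2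
  have := trivialZerosSum_nonneg (x := x) (by linarith)
  rw [chebyshevR] at h
  rw [chebyshevMajorant]
  linarith

lemma le_chebyshevT (hRH : RiemannHypothesis) {x : ℝ} (hx : 2 ≤ x) :
    chebyshevMajorant (-(2 * (logDeriv riemannXi 1).re)) x - 1 / 18 ≤ chebyshevT x := by
  have h := (abs_le.1 (abs_chebyshevR_le hRH (by linarith : 1 < x))).1
  have := trivialZerosSum_le hx
  rw [chebyshevR] at h
  rw [chebyshevMajorant]
  linarith

/-- The weight `1 / (√t log t)`. -/
noncomputable def invSqrtLog (t : ℝ) : ℝ := 1 / (√t * Real.log t)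

/-- Minus the derivative of `invSqrtLog`. -/
noncomputable def invSqrtLogDeriv (t : ℝ) : ℝ :=
  (1 / (2 * Real.log t) + 1 / Real.log t ^ 2) / (t * √t)

/-- The second derivative of `invSqrtLog`. -/
noncomputable def invSqrtLogDeriv₂ (t : ℝ) : ℝ :=
  (3 / (4 * Real.log t) + 2 / Real.log t ^ 2 + 2 / Real.log t ^ 3) / (t ^ 2 * √t)

lemma hasDerivAt_invSqrtLog {t : ℝ} (ht : 1 < t) :
    HasDerivAt invSqrtLog (-invSqrtLogDeriv t) t := by
  have ht0 : 0 < t := by linarith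
  have hl := Real.log_pos ht
  have hs := Real.sqrt_pos.2 ht0
  have h := ((Real.hasDerivAt_sqrt ht0.ne').mul (Real.hasDerivAt_log ht0.ne')).inv
    (mul_pos hs hl).ne'
  have e : invSqrtLog = ((fun x => √x) * Real.log)⁻¹ := by ext; simp [invSqrtLog]
  rw [e]
  refine h.congr_deriv ?_
  have h2 := Real.sq_sqrt ht0.le
  simp only [invSqrtLogDeriv, Pi.mul_apply]
  generalize Real.log t = L at hl ⊢
  set s := √t
  rw [← h2]
  field_simp

lemma hasDerivAt_invSqrtLogDeriv {t : ℝ} (ht : 1 < t) :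
    HasDerivAt invSqrtLogDeriv (-invSqrtLogDeriv₂ t) t := by
  have ht0 : 0 < t := by linarith
  have hl := Real.log_pos ht
  have hs := Real.sqrt_pos.2 ht0
  have dl := Real.hasDerivAt_log ht0.ne'
  have d1 := (hasDerivAt_const t (1 : ℝ)).div (dl.const_mul 2) (by positivity)
  have d2 := (hasDerivAt_const t (1 : ℝ)).div (dl.pow 2) (pow_ne_zero 2 hl.ne')
  have d3 := (hasDerivAt_id t).mul (Real.hasDerivAt_sqrt ht0.ne')
  have h := (d1.add d2).div d3 (by simp only [id, Pi.mul_apply]; positivity)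
  refine HasDerivAt.congr_deriv (f := invSqrtLogDeriv) h ?_
  have h2 := Real.sq_sqrt ht0.le
  simp only [invSqrtLogDeriv₂, Pi.mul_apply, Pi.add_apply, Pi.div_apply, Pi.pow_apply, id]
  generalize Real.log t = L at hl ⊢
  set s := √t
  rw [← h2]
  field_simp
  ring

/-- The function equal to `φ n` on `t ≤ n` and to `φ t - φ' t * (t - n)` on `t ≥ n`,
where `φ = invSqrtLog`. -/
noncomputable def tangentKernel (n t : ℝ) : ℝ :=
  invSqrtLog (max t n) + invSqrtLogDeriv (max t n) * (max t n - n)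

lemma continuousOn_tangentKernel (n : ℝ) : ContinuousOn (tangentKernel n) (Ioi 1) := by
  have h1 : ContinuousOn invSqrtLog (Ioi 1) := fun t ht =>
    (hasDerivAt_invSqrtLog ht).continuousAt.continuousWithinAt
  have h2 : ContinuousOn invSqrtLogDeriv (Ioi 1) := fun t ht =>
    (hasDerivAt_invSqrtLogDeriv ht).continuousAt.continuousWithinAt
  have hm : ContinuousOn (fun t : ℝ => max t n) (Ioi 1) := by fun_prop
  have hmaps : MapsTo (fun t : ℝ => max t n) (Ioi 1) (Ioi 1) := fun t ht =>
    mem_Ioi.2 (lt_max_of_lt_left (mem_Ioi.1 ht))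
  exact (h1.comp hm hmaps).add ((h2.comp hm hmaps).mul (hm.sub continuousOn_const))

lemma hasDerivWithinAt_tangentKernel (n : ℝ) {t : ℝ} (ht : 1 < t) :
    HasDerivWithinAt (tangentKernel n) (-invSqrtLogDeriv₂ t * max (t - n) 0) (Ici t) t := by
  rcases lt_or_ge t n with h | h
  · rw [max_eq_right (by linarith), mul_zero]
    refine HasDerivAt.hasDerivWithinAt ?_
    refine (hasDerivAt_const t (invSqrtLog n)).congr_of_eventuallyEq ?_
    filter_upwards [eventually_lt_nhds h] with z hz
    simp [tangentKernel, max_eq_right hz.le]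
  · rw [max_eq_left (by linarith)]
    have hd := (hasDerivAt_invSqrtLog ht).add
      ((hasDerivAt_invSqrtLogDeriv ht).mul ((hasDerivAt_id t).sub_const n))
    refine (HasDerivWithinAt.congr_deriv hd.hasDerivWithinAt ?_).congr_of_mem (fun z hz => ?_)
      self_mem_Ici
    · simp only [id]; ring
    · simp [tangentKernel, max_eq_left (h.trans hz)]

lemma tangentKernel_of_le {n t : ℝ} (h : t ≤ n) : tangentKernel n t = invSqrtLog n := by
  simp [tangentKernel, max_eq_right h]

lemma tangentKernel_of_ge {n t : ℝ} (h : n ≤ t) :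
    tangentKernel n t = invSqrtLog t + invSqrtLogDeriv t * (t - n) := by
  simp [tangentKernel, max_eq_left h]

lemma tangentKernel_le {n t : ℝ} (hn : 0 ≤ n) (h : n ≤ t) (ht : Real.exp 1 ≤ t) :
    tangentKernel n t ≤ 3 / √t := by
  have ht0 : 0 < t := (Real.exp_pos 1).trans_le ht
  have hl : 1 ≤ Real.log t := by rwa [Real.le_log_iff_exp_le ht0]
  have hs := Real.sqrt_pos.2 ht0
  have h1 : invSqrtLog t ≤ 1 / √t := by
    rw [invSqrtLog]
    gcongr
    nlinarith
  have h2 : invSqrtLogDeriv t ≤ 2 / (t * √t) := by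
    rw [invSqrtLogDeriv]
    gcongr
    have h3 : 1 / (2 * Real.log t) ≤ 1 := by rw [div_le_one (by linarith)]; linarith
    have h4 : 1 / Real.log t ^ 2 ≤ 1 := by rw [div_le_one (by positivity)]; nlinarith
    linarith
  have h5 : invSqrtLogDeriv t * (t - n) ≤ 2 / (t * √t) * t :=
    mul_le_mul h2 (by linarith) (by linarith) (by positivity)
  rw [tangentKernel_of_ge h]
  have : 2 / (t * √t) * t = 2 / √t := by field_simp
  have : 3 / √t = 1 / √t + 2 / √t := by ring
  linarith

/-- An antiderivative majorizing `-invSqrtLogDeriv₂ * chebyshevMajorant l`. -/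
noncomputable def sumMajorant (l t : ℝ) : ℝ :=
  invSqrtLogDeriv t * chebyshevMajorant l t +
    invSqrtLog t * (Real.log t - Real.eulerMascheroniConstant + l / (2 * √t)) +
    2 * (Real.log t + 2) / (√t * Real.log t * (Real.log t + 4))

lemma hasDerivAt_chebyshevMajorant (l : ℝ) {t : ℝ} (ht : 0 < t) :
    HasDerivAt (chebyshevMajorant l)
      (Real.log t - Real.eulerMascheroniConstant + l / (2 * √t)) t := by
  have h := ((((hasDerivAt_id t).mul (Real.hasDerivAt_log ht.ne')).sub
    ((hasDerivAt_id t).const_mul (1 + Real.eulerMascheroniConstant))).add_const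
    (Real.log (2 * Real.pi))).add ((Real.hasDerivAt_sqrt ht.ne').const_mul l)
  refine HasDerivAt.congr_deriv (f := chebyshevMajorant l) h ?_
  simp only [id]
  field_simp
  ring

lemma exists_hasDerivAt_sumMajorant {l : ℝ} (hl : 0 ≤ l) {t : ℝ} (ht : 1 < t) :
    ∃ d, HasDerivAt (sumMajorant l) d t ∧ d ≤ -invSqrtLogDeriv₂ t * chebyshevMajorant l t := by
  have ht0 : 0 < t := by linarith
  have hL := Real.log_pos ht
  have hs := Real.sqrt_pos.2 ht0
  have dl := Real.hasDerivAt_log ht0.ne'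
  have ds := Real.hasDerivAt_sqrt ht0.ne'
  have dQ := hasDerivAt_chebyshevMajorant l ht0
  have dQ' : HasDerivAt
      (fun t => Real.log t - Real.eulerMascheroniConstant + l / (2 * √t))
      (1 / t - l / (4 * (t * √t))) t := by
    have h := (dl.sub_const Real.eulerMascheroniConstant).add
      ((hasDerivAt_const t l).div (ds.const_mul 2) (by positivity))
    refine HasDerivAt.congr_deriv h ?_
    have h2 := Real.sq_sqrt ht0.le
    set s := √t
    rw [← h2]
    field_simp
    ring
  have dW : HasDerivAt
      (fun t => 2 * (Real.log t + 2) / (√t * Real.log t * (Real.log t + 4)))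
      (-(1 / Real.log t + 1 / (Real.log t + 4) + 2 / Real.log t ^ 2 + 2 / (Real.log t + 4) ^ 2) /
        (2 * (t * √t))) t := by
    have h := ((dl.add_const 2).const_mul 2).div ((ds.mul dl).mul (dl.add_const 4))
      (by simp only [Pi.mul_apply]; positivity)
    refine HasDerivAt.congr_deriv h ?_
    have h2 := Real.sq_sqrt ht0.le
    simp only [Pi.mul_apply]
    generalize Real.log t = L at hL ⊢
    set s := √t
    rw [← h2]
    field_simp
    ring
  refine ⟨_, (((hasDerivAt_invSqrtLogDeriv ht).mul dQ).add
    ((hasDerivAt_invSqrtLog ht).mul dQ')).add dW, ?_⟩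
  have hphi : 0 ≤ invSqrtLog t := by rw [invSqrtLog]; positivity
  have h1 : invSqrtLog t * (1 / t - l / (4 * (t * √t))) ≤ invSqrtLog t * (1 / t) := by
    refine mul_le_mul_of_nonneg_left ?_ hphi
    have : 0 ≤ l / (4 * (t * √t)) := by positivity
    linarith
  have h2 : invSqrtLog t * (1 / t) ≤
      (1 / Real.log t + 1 / (Real.log t + 4) + 2 / Real.log t ^ 2 + 2 / (Real.log t + 4) ^ 2) /
        (2 * (t * √t)) := by
    have e : invSqrtLog t * (1 / t) = 2 / Real.log t / (2 * (t * √t)) := by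
      rw [invSqrtLog]; field_simp
    rw [e]
    refine div_le_div_of_nonneg_right ?_ (by positivity)
    have e2 : 1 / Real.log t + 1 / (Real.log t + 4) + 2 / Real.log t ^ 2 +
        2 / (Real.log t + 4) ^ 2 - 2 / Real.log t =
        2 * (1 / Real.log t - 1 / (Real.log t + 4)) ^ 2 := by
      field_simp; ring
    have := sq_nonneg (1 / Real.log t - 1 / (Real.log t + 4))
    linarith
  rw [neg_div]
  linarith

lemma sum_vonMangoldt_div_mul_max_le {t : ℝ} (N : ℕ) :
    ∑ n ∈ Finset.range N, ArithmeticFunction.vonMangoldt n / n * max (t - n) 0 ≤ chebyshevT t := by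
  obtain ⟨M, hM⟩ := exists_nat_ge (max t N)
  have hN : N ≤ M := by exact_mod_cast (le_max_right t N).trans hM
  rw [chebyshevT_eq_sum ((le_max_left t N).trans hM)]
  have e (n : ℕ) : ArithmeticFunction.vonMangoldt n / n * max (t - n) 0 =
      ArithmeticFunction.vonMangoldt n * max (t / n - 1) 0 := by
    rcases eq_or_ne n 0 with rfl | hn
    · simp
    have hn' : (0 : ℝ) < n := by exact_mod_cast Nat.pos_of_ne_zero hn
    rw [div_mul_eq_mul_div, mul_div_assoc, ← max_div_div_right hn'.le, sub_div, div_self hn'.ne',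
      zero_div]
  simp only [e]
  refine Finset.sum_le_sum_of_subset_of_nonneg (Finset.range_mono hN) fun n _ _ => ?_
  exact mul_nonneg ArithmeticFunction.vonMangoldt_nonneg (le_max_right _ _)

lemma sum_mul_tangentKernel_le {l : ℝ} (hl : 0 ≤ l)
    (hT : ∀ t, 1 < t → chebyshevT t ≤ chebyshevMajorant l t) {x : ℝ} (hx : 1 < x) (N : ℕ) :
    ∑ n ∈ Finset.range N, ArithmeticFunction.vonMangoldt n / n * tangentKernel n x ≤
      sumMajorant l x := by
  set Φ : ℝ → ℝ := fun t =>
    ∑ n ∈ Finset.range N, ArithmeticFunction.vonMangoldt n / n * tangentKernel n t with hΦ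
  have hw (n : ℕ) : 0 ≤ ArithmeticFunction.vonMangoldt n / n :=
    div_nonneg ArithmeticFunction.vonMangoldt_nonneg n.cast_nonneg
  choose! d hd hdle using fun t (ht : 1 < t) => exists_hasDerivAt_sumMajorant hl ht
  set Φ' : ℝ → ℝ := fun t => ∑ n ∈ Finset.range N,
    ArithmeticFunction.vonMangoldt n / n * (-invSqrtLogDeriv₂ t * max (t - n) 0) with hΦ'
  have hΦd (t : ℝ) (ht : 1 < t) : HasDerivWithinAt Φ (Φ' t) (Ici t) t :=
    HasDerivWithinAt.fun_sum fun n _ => (hasDerivWithinAt_tangentKernel n ht).const_mul _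
  have hΦc : ContinuousOn Φ (Ioi 1) :=
    continuousOn_finsetSum _ fun n _ => continuousOn_const.mul (continuousOn_tangentKernel n)
  have hΦ'le (t : ℝ) (ht : 1 < t) : d t - Φ' t ≤ 0 := by
    have h1 := sum_vonMangoldt_div_mul_max_le (t := t) N
    have h2 : Φ' t = -invSqrtLogDeriv₂ t *
        ∑ n ∈ Finset.range N, ArithmeticFunction.vonMangoldt n / n * max (t - n) 0 := by
      simp only [hΦ', Finset.mul_sum]
      exact Finset.sum_congr rfl fun n _ => by ring
    have h3 : 0 ≤ invSqrtLogDeriv₂ t := by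
      have := Real.log_pos ht
      rw [invSqrtLogDeriv₂]; positivity
    have h4 := mul_le_mul_of_nonneg_left (h1.trans (hT t ht)) h3
    linarith [hdle t ht]
  have hmono : ∀ y, x ≤ y → sumMajorant l y - Φ y ≤ sumMajorant l x - Φ x := by
    intro y hy
    have hsub (t : ℝ) (ht : t ∈ Icc x y) : 1 < t := hx.trans_le ht.1
    refine image_le_of_deriv_right_le_deriv_boundary (a := x) (b := y)
      (f := fun t => sumMajorant l t - Φ t) (f' := fun t => d t - Φ' t)
      (B := fun _ => sumMajorant l x - Φ x) (B' := fun _ => 0)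
      (fun t ht => ?_) (fun t ht => ?_) le_rfl continuousOn_const
      (fun t _ => hasDerivWithinAt_const _ _ _) (fun t ht => ?_) ⟨hy, le_rfl⟩
    · exact (hd t (hsub t ht)).continuousAt.continuousWithinAt.sub
        ((hΦc t (hsub t ht)).mono fun z hz => hsub z hz)
    · exact (hd t (hx.trans_le ht.1)).hasDerivWithinAt.sub (hΦd t (hx.trans_le ht.1))
    · exact hΦ'le t (hx.trans_le ht.1)
  set C := ∑ n ∈ Finset.range N, ArithmeticFunction.vonMangoldt n / n with hC
  have hlim : Tendsto (fun t : ℝ => -(C * (3 / √t))) atTop (𝓝 (-(C * 0))) :=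
    ((tendsto_const_nhds.div_atTop Real.tendsto_sqrt_atTop).const_mul C).neg
  rw [mul_zero, neg_zero] at hlim
  have hev : ∀ᶠ t : ℝ in atTop, -(C * (3 / √t)) ≤ sumMajorant l x - Φ x := by
    filter_upwards [eventually_ge_atTop x, eventually_ge_atTop (Real.exp 2),
      eventually_ge_atTop (N : ℝ)] with t h1 h2 h3
    refine le_trans ?_ (hmono t h1)
    have ht0 : 0 < t := by linarith
    have hL : 2 ≤ Real.log t := by rwa [Real.le_log_iff_exp_le ht0]
    have he : Real.exp 1 ≤ t := (Real.exp_le_exp.2 (by norm_num)).trans h2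
    have hΦle : Φ t ≤ C * (3 / √t) := by
      simp only [hΦ, hC, Finset.sum_mul]
      refine Finset.sum_le_sum fun n hn => mul_le_mul_of_nonneg_left ?_ (hw n)
      refine tangentKernel_le n.cast_nonneg (le_trans ?_ h3) he
      exact_mod_cast (Finset.mem_range.1 hn).le
    have hγ := Real.eulerMascheroniConstant_lt_two_thirds
    have hG : 0 ≤ sumMajorant l t := by
      have hpi : 0 ≤ Real.log (2 * Real.pi) := Real.log_nonneg (by linarith [Real.pi_gt_three])
      have hQ : 0 ≤ chebyshevMajorant l t := by
        have : 0 ≤ l * √t := by positivity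
        have : 0 ≤ t * (Real.log t - (1 + Real.eulerMascheroniConstant)) :=
          mul_nonneg ht0.le (by linarith)
        rw [chebyshevMajorant]; linarith
      have hQ' : 0 ≤ Real.log t - Real.eulerMascheroniConstant + l / (2 * √t) := by
        have : 0 ≤ l / (2 * √t) := by positivity
        linarith
      have hL0 : 0 < Real.log t := by linarith
      have h1 : 0 ≤ invSqrtLog t := by rw [invSqrtLog]; positivity
      have h2 : 0 ≤ invSqrtLogDeriv t := by rw [invSqrtLogDeriv]; positivity
      rw [sumMajorant]; positivity
    linarith
  have := le_of_tendsto hlim hev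
  linarith

lemma vonMangoldt_div_rpow_mul_log (n : ℕ) :
    ArithmeticFunction.vonMangoldt n / ((n : ℝ) ^ ((3 : ℝ) / 2) * Real.log n) =
      ArithmeticFunction.vonMangoldt n / n * invSqrtLog n := by
  rcases eq_or_ne n 0 with rfl | hn
  · simp
  have hn' : (0 : ℝ) < n := by exact_mod_cast Nat.pos_of_ne_zero hn
  have : (n : ℝ) ^ ((3 : ℝ) / 2) = n * √n := by
    rw [show (3 : ℝ) / 2 = 1 + 1 / 2 by norm_num, Real.rpow_add hn', Real.rpow_one,
      Real.sqrt_eq_rpow]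
  rw [this, invSqrtLog, div_mul_div_comm, mul_one, mul_assoc]

lemma chebyshevT_eq_sum_max {t : ℝ} {N : ℕ} (h : t ≤ N) : chebyshevT t =
    ∑ n ∈ Finset.range N, ArithmeticFunction.vonMangoldt n / n * max (t - n) 0 := by
  rw [chebyshevT_eq_sum h]
  refine Finset.sum_congr rfl fun n _ => ?_
  rcases eq_or_ne n 0 with rfl | hn
  · simp
  have hn' : (0 : ℝ) < n := by exact_mod_cast Nat.pos_of_ne_zero hn
  rw [div_mul_eq_mul_div, mul_div_assoc, ← max_div_div_right hn'.le, sub_div, div_self hn'.ne',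
    zero_div]

lemma sum_tail_le {l : ℝ} (hl : 0 ≤ l)
    (hT : ∀ t, 1 < t → chebyshevT t ≤ chebyshevMajorant l t) {x h : ℝ} (hx : 1 < x) (hh : 0 < h)
    {N : ℕ} (hN : x ≤ N) :
    ∑ n ∈ Finset.range N, (if x < (n : ℝ) then
        ArithmeticFunction.vonMangoldt n / ((n : ℝ) ^ ((3 : ℝ) / 2) * Real.log n) else 0) ≤
      sumMajorant l x - (invSqrtLog x / h + invSqrtLogDeriv x) * chebyshevT x +
        invSqrtLog x / h * chebyshevT (x - h) := by
  have hL := Real.log_pos hx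
  have hφ : 0 ≤ invSqrtLog x := by rw [invSqrtLog]; positivity
  refine le_trans ?_ (add_le_add_left (sub_le_sub_right (sum_mul_tangentKernel_le hl hT hx N) _) _)
  rw [chebyshevT_eq_sum_max hN, chebyshevT_eq_sum_max (by linarith : x - h ≤ N), Finset.mul_sum,
    Finset.mul_sum, ← Finset.sum_sub_distrib, ← Finset.sum_add_distrib]
  refine Finset.sum_le_sum fun n _ => ?_
  have hw : 0 ≤ ArithmeticFunction.vonMangoldt n / n :=
    div_nonneg ArithmeticFunction.vonMangoldt_nonneg n.cast_nonneg
  split_ifs with hn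
  · rw [vonMangoldt_div_rpow_mul_log, tangentKernel_of_le hn.le, max_eq_right (by linarith),
      max_eq_right (by linarith)]
    simp
  · rw [not_lt] at hn
    rw [tangentKernel_of_ge hn, max_eq_left (by linarith : 0 ≤ x - n)]
    have e : ArithmeticFunction.vonMangoldt n / n *
          (invSqrtLog x + invSqrtLogDeriv x * (x - n)) -
        (invSqrtLog x / h + invSqrtLogDeriv x) *
          (ArithmeticFunction.vonMangoldt n / n * (x - n)) +
        invSqrtLog x / h * (ArithmeticFunction.vonMangoldt n / n * max (x - h - n) 0) =
      ArithmeticFunction.vonMangoldt n / n *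
        (invSqrtLog x / h * (max (x - h - n) 0 - (x - h - n))) := by
      field_simp; ring
    rw [e]
    exact mul_nonneg hw (mul_nonneg (by positivity) (sub_nonneg.2 (le_max_left _ _)))

lemma log_two_le_log {x : ℝ} (hx : 2 ≤ x) : 69 / 100 ≤ Real.log x := by
  have := Real.log_two_gt_d9
  have := Real.log_le_log (by norm_num) hx
  linarith

lemma error_bound {x l : ℝ} (hx : 2 ≤ x) (hl : l ≤ 551 / 10000) :
    l / √x * (11 / 2 + Real.log x + 2 / Real.log x) +
        ((Real.log x + 5) / 2 + 1 / Real.log x) / x * (1 / 18) ≤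
      (3 * Real.log x + 10) / (Real.log x + 4) ^ 2 +
        5 * (1 + Real.log x) * Real.log x / (16 * Real.pi * √x) := by
  have hx0 : 0 < x := by linarith
  have hL := log_two_le_log hx
  have hs0 := Real.sqrt_pos.2 hx0
  have hss := Real.sq_sqrt hx0.le
  have hexp : 1 + Real.log x / 2 + Real.log x ^ 2 / 8 ≤ √x := by
    have h1 := Real.quadratic_le_exp_of_nonneg (x := Real.log x / 2) (by linarith)
    have h2 : Real.exp (Real.log x / 2) = √x := by
      rw [Real.sqrt_eq_rpow, Real.rpow_def_of_pos hx0]; ring_nf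
    rw [h2] at h1
    linarith
  have hpi : 551 / 10000 ≤ 5 / (16 * Real.pi) := by
    rw [le_div_iff₀ (by positivity)]
    linarith [Real.pi_lt_d2]
  generalize Real.log x = L at hL hexp ⊢
  have hL0 : 0 < L := by linarith
  have hs : 1414 / 1000 ≤ √x := Real.le_sqrt_of_sq_le (by norm_num; linarith)
  set s := √x
  rw [← hss]
  have hinv : 1 / L ≤ 145 / 100 := by rw [div_le_iff₀ hL0]; linarith
  have h1 : l / s * (11 / 2 + L + 2 / L) ≤
      551 / 10000 / s * (84 / 10) + 5 / (16 * Real.pi) / s * L := by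
    have e : 2 / L = 2 * (1 / L) := by ring
    calc l / s * (11 / 2 + L + 2 / L) ≤ 551 / 10000 / s * (11 / 2 + L + 2 / L) := by gcongr
      _ ≤ 551 / 10000 / s * (84 / 10 + L) :=
          mul_le_mul_of_nonneg_left (by linarith) (by positivity)
      _ = 551 / 10000 / s * (84 / 10) + 551 / 10000 / s * L := by ring
      _ ≤ _ := by gcongr
  have h2 : ((L + 5) / 2 + 1 / L) / s ^ 2 * (1 / 18) ≤ (L / 2 + 395 / 100) / (254 / 10) / s := by
    calc ((L + 5) / 2 + 1 / L) / s ^ 2 * (1 / 18) ≤ (L / 2 + 395 / 100) / s ^ 2 * (1 / 18) := by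
          gcongr ?_ / _ * _; linarith
      _ = (L / 2 + 395 / 100) / (18 * s) / s := by field_simp
      _ ≤ _ := by gcongr; linarith
  have h3 : (551 / 10000 * (84 / 10) + (L / 2 + 395 / 100) / (254 / 10)) / s ≤
      (3 * L + 10) / (L + 4) ^ 2 := by
    rw [div_le_div_iff₀ hs0 (by positivity)]
    refine le_trans ?_ (mul_le_mul_of_nonneg_left hexp (by positivity))
    nlinarith [pow_pos hL0 2, pow_pos hL0 3]
  have h4 : 5 / (16 * Real.pi) / s * L ≤ 5 * (1 + L) * L / (16 * Real.pi * s) := by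
    rw [div_div, div_mul_eq_mul_div]
    gcongr
    nlinarith
  have e : (551 / 10000 * (84 / 10) + (L / 2 + 395 / 100) / (254 / 10)) / s =
    551 / 10000 / s * (84 / 10) + (L / 2 + 395 / 100) / (254 / 10) / s := by ring
  linarith

lemma sumMajorant_sub_le {l x : ℝ} (hl : 0 ≤ l) (hl' : l ≤ 551 / 10000) (hx : 2 ≤ x) {h : ℝ}
    (hh : h = 2 * x / (Real.log x + 4)) :
    sumMajorant l x - (invSqrtLog x / h + invSqrtLogDeriv x) * (chebyshevMajorant (-l) x - 1 / 18) +
        invSqrtLog x / h * chebyshevMajorant l (x - h) ≤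
      2 / (√x * Real.log x) + 5 * (1 + Real.log x) / (16 * Real.pi * x) := by
  have hx0 : 0 < x := by linarith
  have hL := log_two_le_log hx
  have hs0 := Real.sqrt_pos.2 hx0
  have hL0 : 0 < Real.log x := by linarith
  have hh0 : 0 < h := by rw [hh]; positivity
  have hhx : h < x := by
    rw [hh, div_lt_iff₀ (by positivity)]; nlinarith
  have hE := error_bound hx hl'
  have hφ : 0 < invSqrtLog x := by rw [invSqrtLog]; positivity
  have hx_sub : x - h = x * (1 - 2 / (Real.log x + 4)) := by rw [hh]; field_simp
  have hη0 : 0 < 2 / (Real.log x + 4) := by positivity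
  have hη1 : 2 / (Real.log x + 4) < 1 := by rw [div_lt_one (by positivity)]; linarith
  have hlog : Real.log (x - h) ≤
      Real.log x - (2 / (Real.log x + 4) + (2 / (Real.log x + 4)) ^ 2 / 2) := by
    rw [hx_sub, Real.log_mul hx0.ne' (by linarith)]
    have hsum := Real.hasSum_pow_div_log_of_abs_lt_one
      (x := 2 / (Real.log x + 4)) (by rwa [abs_of_pos hη0])
    have := sum_le_hasSum (Finset.range 2) (fun i _ => by positivity) hsum
    norm_num [Finset.sum_range_succ] at this ⊢
    linarith
  have hsq : √(x - h) ≤ √x := Real.sqrt_le_sqrt (by linarith)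
  have hQ : chebyshevMajorant l (x - h) ≤
      (x - h) * (Real.log x - (2 / (Real.log x + 4) + (2 / (Real.log x + 4)) ^ 2 / 2)) -
        (1 + Real.eulerMascheroniConstant) * (x - h) + Real.log (2 * Real.pi) + l * √x := by
    rw [chebyshevMajorant]
    have h1 := mul_le_mul_of_nonneg_left hlog (by linarith : 0 ≤ x - h)
    have h2 := mul_le_mul_of_nonneg_left hsq hl
    linarith
  have hβ : 0 ≤ invSqrtLog x / h := by positivity
  refine (add_le_add_right (mul_le_mul_of_nonneg_left hQ hβ) _).trans ?_
  have hmul := mul_le_mul_of_nonneg_left hE hφ.le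
  have hss := Real.sq_sqrt hx0.le
  have e1 : invSqrtLog x * ((3 * Real.log x + 10) / (Real.log x + 4) ^ 2 +
      5 * (1 + Real.log x) * Real.log x / (16 * Real.pi * √x)) =
      2 / (√x * Real.log x) + 5 * (1 + Real.log x) / (16 * Real.pi * x) -
        invSqrtLog x * (2 - (3 * Real.log x + 10) / (Real.log x + 4) ^ 2) := by
    rw [invSqrtLog]
    generalize Real.log x = L at hL0 ⊢
    set s := √x
    rw [← hss]
    have := Real.pi_pos
    field_simp
    ring
  rw [e1] at hmul
  refine le_trans (le_of_eq ?_) (le_sub_iff_add_le.1 hmul)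
  rw [sumMajorant, invSqrtLogDeriv, invSqrtLog, chebyshevMajorant, chebyshevMajorant, hh]
  generalize Real.log x = L at hL0 ⊢
  generalize Real.log (2 * Real.pi) = c
  generalize Real.eulerMascheroniConstant = γ
  set s := √x
  rw [← hss]
  field_simp
  ring

end

theorem stmt3 (hRH : RiemannHypothesis) (x : ℝ) (hx : 2 ≤ x) :
    (∑' n : ℕ, if x < (n : ℝ) then
        ArithmeticFunction.vonMangoldt n / ((n : ℝ) ^ ((3 : ℝ) / 2) * Real.log n)
      else 0) ≤
      2 / (Real.sqrt x * Real.log x) + 5 * (1 + Real.log x) / (16 * Real.pi * x) := by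
  have hx0 : 0 < x := by linarith
  have hL := log_two_le_log hx
  have hL0 : 0 < Real.log x := by linarith
  have hl : 0 ≤ 2 * (logDeriv riemannXi 1).re := by
    have := re_logDeriv_riemannXi_nonneg hRH (s := 1) (by norm_num)
    linarith
  obtain ⟨h, hh⟩ : ∃ h, h = 2 * x / (Real.log x + 4) := ⟨_, rfl⟩
  have hh0 : 0 < h := by rw [hh]; positivity
  have hxh : 1 < x - h := by
    have : h * (Real.log x + 4) = 2 * x := by rw [hh]; field_simp
    nlinarith
  have hφ : 0 ≤ invSqrtLog x := by rw [invSqrtLog]; positivity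
  have hφ' : 0 ≤ invSqrtLogDeriv x := by rw [invSqrtLogDeriv]; positivity
  have hf (n : ℕ) : 0 ≤ if x < (n : ℝ) then
      ArithmeticFunction.vonMangoldt n / ((n : ℝ) ^ ((3 : ℝ) / 2) * Real.log n) else 0 := by
    split_ifs
    · exact div_nonneg ArithmeticFunction.vonMangoldt_nonneg
        (mul_nonneg (by positivity) (Real.log_natCast_nonneg n))
    · rfl
  refine Real.tsum_le_of_sum_range_le hf fun N => ?_
  have hN : x ≤ (max N ⌈x⌉₊ : ℕ) :=
    (Nat.le_ceil x).trans (Nat.cast_le.2 (le_max_right _ _))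
  refine (Finset.sum_le_sum_of_subset_of_nonneg (Finset.range_mono (le_max_left N ⌈x⌉₊))
    fun n _ _ => hf n).trans <| (sum_tail_le hl (fun t => chebyshevT_le hRH)
      (by linarith) hh0 hN).trans <| le_trans ?_
        (sumMajorant_sub_le hl two_mul_re_logDeriv_riemannXi_one_le hx hh)
  gcongr
  · exact le_chebyshevT hRH hx
  · exact chebyshevT_le hRH hxh
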